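/- Let W be an admissible Wilson loop diagram with k propagators and Grassmann necklace (I_1,...,I_n). Then the denominator R(W) equals the polynomial R = ∏_{i=1}^n r_i produced by the Algorithm, and the ideal generated by R(W) is the radical of the ideal generated by ∏_{i=1}^n Δ_{I_i}, where Δ_{I_i} is the determinant of the k×k minor of C(W) with columns indexed by I_i. -/

import Mathlib

open scoped Classical

namespace WLD

/-- A propagator of a Wilson loop diagram on the cyclically ordered vertex set
`ZMod n` (vertex `n` is identified with `0`): an unordered pair of edges, the
edge joining vertex `i` to vertex `i+1` being labelled `i`. -/
abbrev Prp (n : ℕ) := Sym2 (ZMod n)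

variable (n : ℕ)

/-- The position of `x` in the linear order `i <_i i+1 <_i ⋯ <_i i-1`. -/
def ord (i x : ZMod n) : ℕ := (x - i).val

/-- The other end of a propagator `p` having an end on the edge `e`. -/
noncomputable def otherEnd (p : Prp n) (e : ZMod n) : ZMod n :=
  if h : e ∈ p then Sym2.Mem.other h else e

/-- The vertex support `V(p) = {i, i+1, j, j+1}` of the propagator `p = (i,j)`. -/
def supp (p : Prp n) : Finset (ZMod n) :=
  Sym2.lift ⟨fun i j => {i, i + 1, j, j + 1}, fun i j => by
    ext x
    simp only [Finset.mem_insert, Finset.mem_singleton]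
    tauto⟩ p

/-- The vertex support `V(Q)` of a set of propagators. -/
def suppSet (Q : Finset (Prp n)) : Finset (ZMod n) := Q.biUnion (supp n)

/-- `Prop(U)`: the propagators of `P` supported on (a vertex of) `U`. -/
noncomputable def propsOn (P : Finset (Prp n)) (U : Finset (ZMod n)) : Finset (Prp n) :=
  P.filter fun p => (supp n p ∩ U).Nonempty

/-- Two propagators `p = (i,j)` and `q = (k,l)` cross if `i < k < j < l` cyclically. -/
def Crossing (p q : Prp n) : Prop :=
  ∃ i j k l : ZMod n, p = s(i, j) ∧ q = s(k, l) ∧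
    0 < ord n i k ∧ ord n i k < ord n i j ∧ ord n i j < ord n i l

/-- Weak admissibility of a Wilson loop diagram. -/
structure IsWeaklyAdmissible (P : Finset (Prp n)) : Prop where
  dense : ∀ Q ⊆ P, Q.Nonempty → Q.card + 3 ≤ (suppSet n Q).card
  noncross : ∀ p ∈ P, ∀ q ∈ P, ¬ Crossing n p q

/-- Admissibility of a Wilson loop diagram. -/
structure IsAdmissible (P : Finset (Prp n)) : Prop where
  card_add_four_le : P.card + 4 ≤ n
  dense : ∀ Q ⊆ P, Q.Nonempty → Q.card + 3 ≤ (suppSet n Q).card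
  noncross : ∀ p ∈ P, ∀ q ∈ P, ¬ Crossing n p q

/-- The length of a propagator `p = (i,j)`:
`min(|[i+1, j]|, |[j+1, i]|)`, the number of vertices on its smaller side. -/
def plength (p : Prp n) : ℕ :=
  Sym2.lift ⟨fun i j => min ((j - i - 1).val + 1) ((i - j - 1).val + 1),
    fun _ _ => min_comm _ _⟩ p

/-- `InsideDir n i p q` : the propagator `q = (k,l)` lies (weakly) inside the
propagator `p = (i,j)` directed from its end `i`, i.e. `i ≤_i k <_i l ≤_i j`. -/
def InsideDir (i : ZMod n) (p q : Prp n) : Prop :=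
  ∃ j k l : ZMod n, p = s(i, j) ∧ q = s(k, l) ∧
    ord n i k < ord n i l ∧ ord n i l ≤ ord n i j

/-- Sorting key measuring how far clockwise of the vertex `a` the relevant end of
a propagator supported on `a` is attached: ends on the edge `a-1` are clockwise of
ends on the edge `a`, and on a fixed edge an end is the more clockwise the larger
the propagator is (nestedness of noncrossing propagators sharing an edge). -/
noncomputable def cwKey (a : ZMod n) (p : Prp n) : ℕ :=
  if a - 1 ∈ p then n + ord n (a - 1) (otherEnd n p (a - 1))
  else ord n a (otherEnd n p a)

/-- The clockwise-most propagator of `S` supported on the vertex `a`, if any. -/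
noncomputable def pickCW (S : Finset (Prp n)) (a : ZMod n) : Option (Prp n) :=
  if h : (S.filter fun p => a ∈ supp n p).Nonempty then
    some (Classical.choose
      ((S.filter fun p => a ∈ supp n p).exists_max_image (cwKey n a) h))
  else none

/-- The Grassmann necklace algorithm started at the vertex `i`: after `t` steps,
`(gnRun n P i t).1` is the set of propagators not yet deleted, and
`(gnRun n P i t).2` records the vertex assigned to each deleted propagator.
Step `t+1` processes the vertex `i + t`: if some not-yet-deleted propagator is
supported on it, the clockwise-most such propagator is deleted and assigned
that vertex. -/
noncomputable def gnRun (P : Finset (Prp n)) (i : ZMod n) :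
    ℕ → Finset (Prp n) × (Prp n → Option (ZMod n))
  | 0 => (P, fun _ => none)
  | t + 1 =>
    match pickCW n (gnRun P i t).1 (i + (t : ZMod n)) with
    | none => gnRun P i t
    | some p => ((gnRun P i t).1.erase p,
        Function.update (gnRun P i t).2 p (some (i + (t : ZMod n))))

/-- `I_i^W(p)`: the vertex contributed by the propagator `p` to the Grassmann
necklace term `I_i^W` (as an `Option`; the algorithm makes one full circuit of
the vertex set, i.e. runs for `n` steps). -/
noncomputable def gnAssign (P : Finset (Prp n)) (i : ZMod n) (p : Prp n) :
    Option (ZMod n) :=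
  (gnRun n P i n).2 p

/-- The Grassmann necklace term `I_i^W` produced by the algorithm. -/
noncomputable def gnSet [NeZero n] (P : Finset (Prp n)) (i : ZMod n) :
    Finset (ZMod n) :=
  Finset.univ.filter fun v => ∃ p, gnAssign n P i p = some v

/-- The cyclic interval `{a, a+1, …, a + (len-1)}` in `ZMod n`. -/
def cInterval [NeZero n] (a : ZMod n) (len : ℕ) : Finset (ZMod n) :=
  Finset.univ.filter fun x => ord n a x < len

/-- A Grassmann necklace of type `(k, n)`: a cyclic sequence of `k`-element
subsets of the vertex set such that `I_{i+1} = (I_i \ {i}) ∪ {j}` for some `j`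
whenever `i ∈ I_i`, and `I_{i+1} = I_i` otherwise. -/
def IsGrassmannNecklace [NeZero n] (k : ℕ) (I : ZMod n → Finset (ZMod n)) : Prop :=
  (∀ i, (I i).card = k) ∧
  ∀ i : ZMod n,
    (i ∈ I i → ∃ j : ZMod n, I (i + 1) = insert j ((I i).erase i)) ∧
    (i ∉ I i → I (i + 1) = I i)

/-- Independence in the matroid `M(W)`: no subset `U` of `J` supports fewer
propagators than the vertices it contains. -/
def Indep (P : Finset (Prp n)) (J : Finset (ZMod n)) : Prop :=
  ∀ U ⊆ J, U.card ≤ (propsOn n P U).card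

/-- `A` is lexicographically smaller than `B` with respect to the order `<_i`:
the `<_i`-least element of the symmetric difference lies in `A`. -/
def LexLt (i : ZMod n) (A B : Finset (ZMod n)) : Prop :=
  ∃ v, v ∈ A ∧ v ∉ B ∧ ∀ w, ord n i w < ord n i v → (w ∈ A ↔ w ∈ B)

/-- A `+` is placed in the box `(a, b)` of the Le diagram with row labels `I₁`
by the necklace term `Ii`: writing `I₁ \ Ii = {a₁ > ⋯ > a_r}` and
`Ii \ I₁ = {b₁ < ⋯ < b_r}` in the `<₁` order, the plusses are in the boxes
`(a_t, b_t)`. -/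
def LePlusAt (I₁ Ii : Finset (ZMod n)) (a b : ZMod n) : Prop :=
  a ∈ I₁ \ Ii ∧ b ∈ Ii \ I₁ ∧
    ((I₁ \ Ii).filter fun x => ord n 1 a < ord n 1 x).card =
      ((Ii \ I₁).filter fun y => ord n 1 y < ord n 1 b).card

/-- The box `(a, b)` of the Le diagram of the diagram `P` contains a `+`. -/
def LePlus [NeZero n] (P : Finset (Prp n)) (a b : ZMod n) : Prop :=
  ∃ i : ZMod n, LePlusAt n (gnSet n P 1) (gnSet n P i) a b

/-- The number of `+` entries in the Le diagram of the diagram `P`. -/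
noncomputable def plusCount [NeZero n] (P : Finset (Prp n)) : ℕ :=
  (Finset.univ.filter fun ab : ZMod n × ZMod n => LePlus n P ab.1 ab.2).card

/-- The length of the row labelled `a` of the Young diagram with row labels `I₁`
(the boxes of row `a` are indexed by the column labels `b ∉ I₁` with `a <₁ b`). -/
noncomputable def rowLen [NeZero n] (I₁ : Finset (ZMod n)) (a : ZMod n) : ℕ :=
  (Finset.univ.filter fun b => b ∉ I₁ ∧ ord n 1 a < ord n 1 b).card

/-- The entry of the matrix `C(W)` in row `p` and column `q`: the indeterminate
`x_{p,q}` if `q ∈ V(p)`, and `0` otherwise. -/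
noncomputable def CW (p : Prp n) (q : ZMod n) : MvPolynomial (Prp n × ZMod n) ℝ :=
  if q ∈ supp n p then MvPolynomial.X (p, q) else 0

/-- The column paired with the row `p` in the minors determined by `I_i^W`. -/
noncomputable def colOf (P : Finset (Prp n)) (i : ZMod n) (p : Prp n) : ZMod n :=
  (gnAssign n P i p).getD i

/-- `Δ_{I_i}`: the determinant of the `k × k` minor of `C(W)` on the columns
indexed by `I_i^W`, rows and columns paired via the necklace assignment. -/
noncomputable def Delta (P : Finset (Prp n)) (i : ZMod n) :
    MvPolynomial (Prp n × ZMod n) ℝ :=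
  Matrix.det (Matrix.of fun p q : ↥P => CW n (p : Prp n) (colOf n P i (q : Prp n)))

/-- `S_i`: the propagators whose contribution changes from `I_{i-1}` to `I_i`. -/
noncomputable def Schanged (P : Finset (Prp n)) (i : ZMod n) : Finset (Prp n) :=
  P.filter fun p => gnAssign n P (i - 1) p ≠ gnAssign n P i p

/-- `r_i`: the determinant of the minor of `C(W)` with rows indexed by `S_i` and
columns indexed by `I_i(S_i)` (equal to `1` when `S_i = ∅`). -/
noncomputable def rfac (P : Finset (Prp n)) (i : ZMod n) :
    MvPolynomial (Prp n × ZMod n) ℝ :=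
  Matrix.det
    (Matrix.of fun p q : ↥(Schanged n P i) => CW n (p : Prp n) (colOf n P i (q : Prp n)))

/-- `R = ∏ᵢ rᵢ`, the polynomial produced by the algorithm. -/
noncomputable def Rpoly [NeZero n] (P : Finset (Prp n)) :
    MvPolynomial (Prp n × ZMod n) ℝ :=
  ∏ i : ZMod n, rfac n P i

/-- Position of the end of the propagator `p` along the edge `e`: larger values
attach closer to the vertex `e`, i.e. earlier in the counterclockwise ordering
of the ends of propagators along the edge `e`. -/
noncomputable def edgeKey (e : ZMod n) (p : Prp n) : ℕ := ord n e (otherEnd n p e)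

/-- The propagators of `P` with an end on the edge `e`. -/
noncomputable def onEdge (P : Finset (Prp n)) (e : ZMod n) : Finset (Prp n) :=
  P.filter fun p => e ∈ p

/-- `p` is the first propagator (`p₁`) on the edge `e` in the counterclockwise
ordering of the propagators with an end on the edge `e`. -/
def IsCcwFirst (P : Finset (Prp n)) (e : ZMod n) (p : Prp n) : Prop :=
  p ∈ onEdge n P e ∧ ∀ q ∈ onEdge n P e, edgeKey n e q ≤ edgeKey n e p

/-- `p` is the last propagator (`p_r`) on the edge `e` in the counterclockwise
ordering of the propagators with an end on the edge `e`. -/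
def IsCcwLast (P : Finset (Prp n)) (e : ZMod n) (p : Prp n) : Prop :=
  p ∈ onEdge n P e ∧ ∀ q ∈ onEdge n P e, edgeKey n e p ≤ edgeKey n e q

/-- `p` and `q` are consecutive, in this order (`p = p_j`, `q = p_{j+1}`), in the
counterclockwise ordering of the propagators with an end on the edge `e`. -/
def ConsecOnEdge (P : Finset (Prp n)) (e : ZMod n) (p q : Prp n) : Prop :=
  p ∈ onEdge n P e ∧ q ∈ onEdge n P e ∧ edgeKey n e q < edgeKey n e p ∧
    ∀ r ∈ onEdge n P e, ¬ (edgeKey n e q < edgeKey n e r ∧ edgeKey n e r < edgeKey n e p)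

/-- The factor `R_e` of the denominator `R(W)` associated to the edge `e`:
`R_e = x_{p₁,e+1} • ∏_{j=1}^{r-1} (x_{p_j,e} x_{p_{j+1},e+1} - x_{p_{j+1},e} x_{p_j,e+1}) • x_{p_r,e}`
for the counterclockwise ordering `p₁, …, p_r` of the propagators on the edge `e`
(`R_e = 1` if there are none). -/
noncomputable def Redge (P : Finset (Prp n)) (e : ZMod n) :
    MvPolynomial (Prp n × ZMod n) ℝ :=
  (∏ p ∈ (onEdge n P e).filter (IsCcwFirst n P e), MvPolynomial.X (p, e + 1)) *
    (∏ pq ∈ (P ×ˢ P).filter (fun pq => ConsecOnEdge n P e pq.1 pq.2),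
      (MvPolynomial.X (pq.1, e) * MvPolynomial.X (pq.2, e + 1) -
        MvPolynomial.X (pq.2, e) * MvPolynomial.X (pq.1, e + 1))) *
    (∏ p ∈ (onEdge n P e).filter (IsCcwLast n P e), MvPolynomial.X (p, e))

/-- The denominator `R(W) = ∏ₑ R_e` of the integrand `Ω(W)`. -/
noncomputable def RW [NeZero n] (P : Finset (Prp n)) :
    MvPolynomial (Prp n × ZMod n) ℝ :=
  ∏ e : ZMod n, Redge n P e

/-- The relabelling map associated to the removal of the vertex `i` from the
vertex set `ZMod n`: the vertex of `ZMod (n-1)` in position `t` (in the `<₁`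
order) is sent to the vertex of `ZMod n` in position `t` if `t` precedes the
position of `i`, and to the vertex in position `t+1` otherwise. -/
noncomputable def liftVert (i : ZMod n) (x : ZMod (n - 1)) : ZMod n :=
  1 + ((if ord (n - 1) 1 x < ord n 1 i then ord (n - 1) 1 x
        else ord (n - 1) 1 x + 1 : ℕ) : ZMod n)

end WLD

namespace WLD

/-- In a linear model of the vertex set, `OnV n x y w` says that the vertex at position `w`
supports the propagator joining the edges ending at positions `x` and `y`, where `x < y`. -/
def OnV (n x y w : ℕ) : Prop :=
  w = x ∨ w = y ∨ w + 1 = x ∨ w + 1 = y ∨ (x = 0 ∧ w + 1 = n)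

/-- The vertex support of the propagator joining the edges ending at positions `x < y`. -/
def vset (n x y : ℕ) : Finset ℕ := {x, y, y - 1, if x = 0 then n - 1 else x - 1}

/-- The priority, at the vertex at position `w`, of the propagator joining the edges ending at
positions `x < y`; larger values are more clockwise. -/
def prio (n x y w : ℕ) : ℕ :=
  if x = w then n + (y - x) else if y = w then n + (x + n - y)
  else if w + 1 = x ∨ (x = 0 ∧ w + 1 = n) then y - x else x + n - y

theorem mem_vset {n x y w : ℕ} (h : x < y) (hn : y < n) : w ∈ vset n x y ↔ OnV n x y w := by
  simp only [vset, OnV, Finset.mem_insert, Finset.mem_singleton]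
  split_ifs <;> omega

theorem prio_inj {n x y x' y' w : ℕ} (h : x < y) (hn : y < n) (h' : x' < y') (hn' : y' < n)
    (ho : OnV n x y w) (ho' : OnV n x' y' w) (hk : prio n x y w = prio n x' y' w) :
    x = x' ∧ y = y' := by
  unfold OnV at ho ho'
  unfold prio at hk
  split_ifs at hk <;> omega

/-- The linear picture of the Grassmann necklace algorithm from a fixed starting vertex: the
propagator `p` joins the edges ending at positions `x p < y p`, and `c p` is the position of the
vertex it contributes, with `n ≤ c p` if there is none. -/
structure LinModel {ι : Type*} (n : ℕ) (P : Finset ι) (x y c : ι → ℕ) : Prop where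
  lt : ∀ p ∈ P, x p + 2 ≤ y p
  yn : ∀ p ∈ P, y p < n
  wrap : ∀ p ∈ P, x p = 0 → y p + 1 < n
  inj : ∀ p ∈ P, ∀ q ∈ P, x p = x q → y p = y q → p = q
  nc : ∀ p ∈ P, ∀ q ∈ P, ¬ (x p < x q ∧ x q < y p ∧ y p < y q)
  dense : ∀ Q ⊆ P, Q.Nonempty → Q.card + 3 ≤ (Q.biUnion fun p => vset n (x p) (y p)).card
  c_mem : ∀ p ∈ P, c p < n → OnV n (x p) (y p) (c p)
  c_inj : ∀ p ∈ P, ∀ q ∈ P, c p = c q → c p < n → p = q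
  c_occ : ∀ p ∈ P, ∀ w, OnV n (x p) (y p) w → w < c p → w < n →
    ∃ q ∈ P, c q = w ∧ OnV n (x q) (y q) w ∧ prio n (x p) (y p) w < prio n (x q) (y q) w

namespace LinModel
variable {ι : Type*} {n : ℕ} {P : Finset ι} {x y c : ι → ℕ}

/-- `q` lies strictly inside `p`. -/
def Inside (x y : ι → ℕ) (p q : ι) : Prop := x p ≤ x q ∧ y q ≤ y p ∧ ¬ (x p = x q ∧ y p = y q)

/-- A propagator that has priority at the vertex contributed by another one has already been
deleted there. -/
theorem lt_of_prio (M : LinModel n P x y c) {p q : ι} (hp : p ∈ P) (hq : q ∈ P) (hc : c p < n)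
    (hs : OnV n (x q) (y q) (c p))
    (hk : prio n (x p) (y p) (c p) < prio n (x q) (y q) (c p)) : c q < c p := by
  by_contra hlt
  rcases Nat.lt_or_ge (c p) (c q) with h | h
  · obtain ⟨r, hr, hcr, -, hk'⟩ := M.c_occ q hq _ hs h hc
    have := M.c_inj p hp r hr hcr.symm hc
    subst this
    omega
  · have := M.c_inj p hp q hq (by omega) hc
    subst this
    omega

/-- If `Q` collects propagators contributing positions up to `v` by walking back from `v`, the
support of `Q` up to `v` is almost exhausted by `Q`. -/
theorem exists_walk (M : LinModel n P x y c) (R : ι → Prop) (L : Finset ℕ) (hL : L.card ≤ 2)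
    (hRP : ∀ r, R r → r ∈ P)
    (hrule : ∀ r, R r → c r + 1 = x r ∨ c r = x r ∨ c r + 1 = y r)
    (h1 : ∀ r, R r → ∀ q ∈ P, ¬ R q → c q + 1 = x r → OnV n (x q) (y q) (c q) →
      prio n (x r) (y r) (c q) < prio n (x q) (y q) (c q) → x r - 1 ∈ L)
    (h2 : ∀ r, R r → ∀ q ∈ P, ¬ R q → c q = x r → OnV n (x q) (y q) (c q) →
      prio n (x r) (y r) (c q) < prio n (x q) (y q) (c q) →
      x r ∈ L ∧ (x r ≠ 0 → x r - 1 ∈ L)) :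
    ∀ v r, R r → c r = v → ∃ Q ⊆ P, r ∈ Q ∧ (∀ q ∈ Q, R q ∧ c q ≤ v) ∧
      (((Q.biUnion fun p => vset n (x p) (y p)).filter (· ≤ v)) ∪ L).card ≤ Q.card + 2 := by
  intro v
  induction v using Nat.strong_induction_on with
  | _ v ih =>
  intro r hr hv
  have hrP := hRP r hr
  have hlt := M.lt r hrP
  have hyn := M.yn r hrP
  have hwr := M.wrap r hrP
  -- the case where `r` alone suffices
  have single : (∀ w, OnV n (x r) (y r) w → w ≤ v → w = v ∨ w ∈ L) →
      ∃ Q ⊆ P, r ∈ Q ∧ (∀ q ∈ Q, R q ∧ c q ≤ v) ∧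
      (((Q.biUnion fun p => vset n (x p) (y p)).filter (· ≤ v)) ∪ L).card ≤ Q.card + 2 := by
    intro h
    refine ⟨{r}, by simpa using hrP, by simp, by simp [hr, hv], ?_⟩
    have : (((({r} : Finset ι).biUnion fun p => vset n (x p) (y p)).filter (· ≤ v)) ∪ L)
        ⊆ insert v L := by
      intro w hw
      simp only [Finset.singleton_biUnion, Finset.mem_union, Finset.mem_filter] at hw
      rcases hw with ⟨hw, hwv⟩ | hw
      · rw [mem_vset (by omega) hyn] at hw
        rcases h w hw hwv with h | h <;> simp [h]
      · simp [hw]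
    have h1 := Finset.card_le_card this
    have h2 := Finset.card_insert_le v L
    simp only [Finset.card_singleton]
    omega
  -- the case where `r` is added to an earlier walk
  have extend : ∀ u < v, ∀ s, R s → c s = u →
      (∀ Q ⊆ P, s ∈ Q → (∀ q ∈ Q, R q ∧ c q ≤ u) → ∀ w ≤ v, w ≠ v → 
        (w ∈ Q.biUnion (fun p => vset n (x p) (y p)) ∨ OnV n (x r) (y r) w) →
        (w ≤ u ∧ w ∈ Q.biUnion (fun p => vset n (x p) (y p))) ∨ w ∈ L) →
      ∃ Q ⊆ P, r ∈ Q ∧ (∀ q ∈ Q, R q ∧ c q ≤ v) ∧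
      (((Q.biUnion fun p => vset n (x p) (y p)).filter (· ≤ v)) ∪ L).card ≤ Q.card + 2 := by
    intro u hu s hs hsu h
    obtain ⟨Q, hQP, hsQ, hQ, hcard⟩ := ih u hu s hs hsu
    have hrQ : r ∉ Q := fun hrQ => by have := (hQ r hrQ).2; omega
    refine ⟨insert r Q, Finset.insert_subset hrP hQP, Finset.mem_insert_self _ _, ?_, ?_⟩
    · intro q hq
      rcases Finset.mem_insert.1 hq with rfl | hq
      · exact ⟨hr, hv.le⟩
      · exact ⟨(hQ q hq).1, by have := (hQ q hq).2; omega⟩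
    · have : ((((insert r Q).biUnion fun p => vset n (x p) (y p)).filter (· ≤ v)) ∪ L)
          ⊆ insert v (((Q.biUnion fun p => vset n (x p) (y p)).filter (· ≤ u)) ∪ L) := by
        intro w hw
        rw [Finset.biUnion_insert, Finset.mem_union, Finset.mem_filter, Finset.mem_union,
          mem_vset (by omega) hyn] at hw
        rw [Finset.mem_insert, Finset.mem_union, Finset.mem_filter]
        rcases hw with ⟨hw, hwv⟩ | hw
        · by_cases hwv' : w = v
          · exact Or.inl hwv'
          · rcases h Q hQP hsQ hQ w hwv hwv' hw.symm with h | h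
            · exact Or.inr (Or.inl h.symm)
            · exact Or.inr (Or.inr h)
        · exact Or.inr (Or.inr hw)
      have h1 := Finset.card_le_card this
      have h2 := Finset.card_insert_le v
        (((Q.biUnion fun p => vset n (x p) (y p)).filter (· ≤ u)) ∪ L)
      rw [Finset.card_insert_of_notMem hrQ]
      omega
  have mem_of : ∀ Q ⊆ P, ∀ s ∈ Q, ∀ w, OnV n (x s) (y s) w →
      w ∈ Q.biUnion fun p => vset n (x p) (y p) := fun Q hQ s hs w hw =>
    Finset.mem_biUnion.2 ⟨s, hs, (mem_vset (by have := M.lt s (hQ hs); omega)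
      (M.yn s (hQ hs))).2 hw⟩
  rcases hrule r hr with h | h | h
  · refine single fun w hw hwv => ?_
    unfold OnV at hw; omega
  · by_cases hx0 : x r = 0
    · refine single fun w hw hwv => ?_
      unfold OnV at hw; omega
    · obtain ⟨q, hq, hcq, hoq, hk⟩ := M.c_occ r hrP (x r - 1) (by unfold OnV; omega) (by omega)
        (by omega)
      by_cases hqR : R q
      · refine extend (x r - 1) (by omega) q hqR hcq ?_
        rintro Q hQP hqQ hQ w hwv hwv' (hw | hw)
        · exact Or.inl ⟨by omega, hw⟩
        · have : w = x r - 1 := by unfold OnV at hw; omega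
          subst this
          exact Or.inl ⟨le_rfl, mem_of Q hQP q hqQ _ hoq⟩
      · rw [← hcq] at hoq hk
        have := h1 r hr q hq hqR (by omega) hoq hk
        refine single fun w hw hwv => ?_
        have : w = v ∨ w = x r - 1 := by unfold OnV at hw; omega
        rcases this with h | rfl
        · exact Or.inl h
        · exact Or.inr ‹_›
  · obtain ⟨s, hs, hcs, hos, hk⟩ := M.c_occ r hrP (x r) (by unfold OnV; omega) (by omega)
        (by omega)
    have hlts := M.lt s hs
    have hyns := M.yn s hs
    have hsx : x s = x r ∨ y s = x r := by
      unfold OnV at hos; unfold prio at hk; split_ifs at hk <;> omega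
    by_cases hsR : R s
    · refine extend (x r) (by omega) s hsR hcs ?_
      rintro Q hQP hsQ hQ w hwv hwv' (hw | hw)
      · rcases Nat.lt_or_ge (x r) w with hxw | hxw
        · exfalso
          obtain ⟨q, hqQ, hqw⟩ := Finset.mem_biUnion.1 hw
          have hqP := hQP hqQ
          have hltq := M.lt q hqP
          have hynq := M.yn q hqP
          rw [mem_vset (by omega) (M.yn q hqP)] at hqw
          obtain ⟨hqR, hqc⟩ := hQ q hqQ
          have n1 := M.nc q hqP r hrP
          have n2 := M.nc r hrP q hqP
          have hin : x r ≤ x q ∧ y q ≤ y r := by unfold OnV at hqw; omega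
          have hqr : ¬ (x r = x q ∧ y r = y q) := by
            rintro ⟨e1, e2⟩
            have := M.inj r hrP q hqP e1 e2
            subst this; omega
          rcases hrule q hqR with h' | h' | h'
          · have := M.lt_of_prio (p := q) (q := r) hqP hrP (by omega) (by unfold OnV; omega)
              (by unfold prio; split_ifs <;> omega)
            omega
          · have := M.c_inj q hqP s hs (by omega) (by omega)
            subst this
            unfold prio at hk; split_ifs at hk <;> omega
          · omega
        · exact Or.inl ⟨hxw, hw⟩
      · have hw' : w = x r ∨ w + 1 = x r := by unfold OnV at hw; omega
        refine Or.inl ⟨by omega, mem_of Q hQP s hsQ _ ?_⟩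
        unfold OnV; omega
    · obtain ⟨ha, hb⟩ := h2 r hr s hs hsR hcs (by rwa [hcs]) (by rwa [hcs])
      refine single fun w hw hwv => ?_
      have : w = v ∨ w = x r ∨ (x r ≠ 0 ∧ w = x r - 1) := by unfold OnV at hw; omega
      rcases this with h | rfl | ⟨h, rfl⟩
      · exact Or.inl h
      · exact Or.inr ha
      · exact Or.inr (hb h)


theorem rule_of_inside (M : LinModel n P x y c) {p : ι} (hp : p ∈ P)
    (h : ∀ r ∈ P, Inside x y p r → c r + 1 < y p) :
    c p + 1 = x p ∨ c p = x p ∨ c p + 1 = y p := by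
  have hlt := M.lt p hp
  have hyn := M.yn p hp
  have hle : c p + 1 ≤ y p := by
    by_contra hcon
    obtain ⟨q, hq, hcq, hoq, hk⟩ := M.c_occ p hp (y p - 1) (by unfold OnV; omega) (by omega)
      (by omega)
    have hltq := M.lt q hq
    have hynq := M.yn q hq
    have n1 := M.nc p hp q hq
    have n2 := M.nc q hq p hp
    have : Inside x y p q := by
      unfold Inside; unfold OnV at hoq; unfold prio at hk
      split_ifs at hk <;> omega
    have := h q hq this
    omega
  have := M.c_mem p hp (by omega)
  unfold OnV at this; omega

/-- A propagator strictly inside `p` contributes a vertex preceding the edge at the far end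
of `p`. -/
theorem lt_of_inside (M : LinModel n P x y c) : ∀ p ∈ P, ∀ r ∈ P, Inside x y p r →
    c r + 1 < y p := by
  suffices ∀ m, ∀ p ∈ P, y p - x p = m → ∀ r ∈ P, Inside x y p r → c r + 1 < y p from
    fun p hp => this _ p hp rfl
  intro m
  induction m using Nat.strong_induction_on with
  | _ m ih =>
  intro p hp hm r hr hin
  have hlt := M.lt p hp
  have hyn := M.yn p hp
  have hrule : ∀ r, r ∈ P ∧ Inside x y p r → c r + 1 = x r ∨ c r = x r ∨ c r + 1 = y r := by
    rintro r ⟨hr, hin⟩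
    have := M.lt r hr
    refine M.rule_of_inside hr (ih (y r - x r) ?_ r hr rfl)
    unfold Inside at hin; omega
  have hltr := M.lt r hr
  have hynr := M.yn r hr
  by_contra hcon
  have hcr : c r + 1 = y p := by
    have := hrule r ⟨hr, hin⟩
    unfold Inside at hin; omega
  set L : Finset ℕ := {x p, if x p = 0 then n - 1 else x p - 1} with hL
  have memL : ∀ w, w ∈ L ↔ w = x p ∨ w + 1 = x p ∨ (x p = 0 ∧ w + 1 = n) := by
    intro w
    rw [hL, Finset.mem_insert, Finset.mem_singleton]
    split_ifs <;> omega
  have key : ∀ r, r ∈ P ∧ Inside x y p r → ∀ q ∈ P, ¬ (q ∈ P ∧ Inside x y p q) →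
      OnV n (x q) (y q) (c q) → prio n (x r) (y r) (c q) < prio n (x q) (y q) (c q) →
      (c q = x r → x r = x p) ∧ (c q + 1 = x r → x r = x p ∨ x r = x p + 1) := by
    rintro r ⟨hr, hin⟩ q hq hqR ho hk
    have hqR : ¬ Inside x y p q := fun h => hqR ⟨hq, h⟩
    have hltr := M.lt r hr
    have hynr := M.yn r hr
    have hltq := M.lt q hq
    have hynq := M.yn q hq
    have n1 := M.nc p hp q hq
    have n2 := M.nc q hq p hp
    unfold Inside at hin hqR
    unfold OnV at ho
    constructor
    · intro h
      unfold prio at hk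
      split_ifs at hk <;> omega
    · intro h
      omega
  obtain ⟨Q, hQP, hrQ, hQ, hcard⟩ := M.exists_walk (fun r => r ∈ P ∧ Inside x y p r) L
    (Finset.card_le_two) (fun r h => h.1) hrule
    (by
      intro r hr q hq hqR hcq ho hk
      have := (key r hr q hq hqR ho hk).2 hcq
      rw [memL]; omega)
    (by
      intro r hr q hq hqR hcq ho hk
      have := (key r hr q hq hqR ho hk).1 hcq
      rw [memL, memL]; omega)
    (c r) r ⟨hr, hin⟩ rfl
  have hpQ : p ∉ Q := fun h => by
    have := (hQ p h).1.2
    unfold Inside at this; omega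
  have hd := M.dense (insert p Q) (Finset.insert_subset hp hQP) (Finset.insert_nonempty _ _)
  have hsub : ((insert p Q).biUnion fun p => vset n (x p) (y p)) ⊆
      insert (y p) (((Q.biUnion fun p => vset n (x p) (y p)).filter (· ≤ c r)) ∪ L) := by
    intro w hw
    rw [Finset.mem_insert, Finset.mem_union, Finset.mem_filter, memL]
    rw [Finset.biUnion_insert, Finset.mem_union, mem_vset (by omega) hyn] at hw
    rcases hw with hw | hw
    · by_cases hwr : w = c r
      · subst hwr
        refine Or.inr (Or.inl ⟨Finset.mem_biUnion.2 ⟨r, hrQ, ?_⟩, le_rfl⟩)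
        rw [mem_vset (by omega) hynr]
        exact M.c_mem r hr (by omega)
      · unfold OnV at hw
        omega
    · by_cases hwr : w ≤ c r
      · exact Or.inr (Or.inl ⟨hw, hwr⟩)
      · obtain ⟨q, hqQ, hqw⟩ := Finset.mem_biUnion.1 hw
        have hltq := M.lt q (hQP hqQ)
        have hynq := M.yn q (hQP hqQ)
        rw [mem_vset (by omega) hynq] at hqw
        have := (hQ q hqQ).1.2
        unfold Inside at this
        unfold OnV at hqw
        omega
  have h1 := Finset.card_le_card hsub
  have h2 := Finset.card_insert_le (y p)
    (((Q.biUnion fun p => vset n (x p) (y p)).filter (· ≤ c r)) ∪ L)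
  rw [Finset.card_insert_of_notMem hpQ] at hd
  omega

/-- A propagator contributes a vertex of the first edge it meets, or else the first vertex of
the second one. -/
theorem rule (M : LinModel n P x y c) {p : ι} (hp : p ∈ P) :
    c p + 1 = x p ∨ c p = x p ∨ c p + 1 = y p :=
  M.rule_of_inside hp (M.lt_of_inside p hp)

theorem lt_n (M : LinModel n P x y c) {p : ι} (hp : p ∈ P) : c p < n := by
  have := M.rule hp
  have := M.lt p hp
  have := M.yn p hp
  omega

theorem onV (M : LinModel n P x y c) {p : ι} (hp : p ∈ P) : OnV n (x p) (y p) (c p) :=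
  M.c_mem p hp (M.lt_n hp)

theorem c_injective (M : LinModel n P x y c) {p q : ι} (hp : p ∈ P) (hq : q ∈ P)
    (h : c p = c q) : p = q :=
  M.c_inj p hp q hq h (M.lt_n hp)

/-- If the starting vertex immediately follows an edge on which `p` ends, then `p` contributes
the first vertex of its other edge. -/
theorem eq_first_of_last (M : LinModel n P x y c) {p : ι} (hp : p ∈ P) (hl : y p + 1 = n) :
    c p + 1 = x p := by
  have hlt := M.lt p hp
  have hwr := M.wrap p hp
  by_contra hcon
  obtain ⟨r, hr, hcr, hor, hk⟩ : ∃ q ∈ P, c q = x p - 1 ∧ OnV n (x q) (y q) (x p - 1) ∧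
      prio n (x p) (y p) (x p - 1) < prio n (x q) (y q) (x p - 1) :=
    M.c_occ p hp (x p - 1) (by unfold OnV; omega) (by have := M.rule hp; omega) (by omega)
  have hltr := M.lt r hr
  have hynr := M.yn r hr
  set R : ι → Prop := fun r => r ∈ P ∧ x r < x p ∧ (y r ≤ x p ∨ y r + 1 = n) with hR
  have hnear : ∀ q ∈ P, c q + 1 < x p → R q := by
    intro q hq hcq
    have ho := M.onV hq
    have hltq := M.lt q hq
    have hynq := M.yn q hq
    have n1 := M.nc p hp q hq
    have n2 := M.nc q hq p hp
    have := M.rule hq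
    refine ⟨hq, ?_⟩
    omega
  have hrR : R r := by
    have n1 := M.nc p hp r hr
    have n2 := M.nc r hr p hp
    have := M.rule hr
    refine ⟨hr, ?_⟩
    unfold OnV at hor
    unfold prio at hk
    split_ifs at hk <;> omega
  obtain ⟨Q, hQP, hrQ, hQ, hcard⟩ := M.exists_walk (fun r => R r ∧ c r < x p) {n - 1, n - 2}
    (Finset.card_le_two) (fun r h => h.1.1) (fun r h => M.rule h.1.1)
    (by
      intro r hr q hq hqR hcq ho hk
      exact absurd ⟨hnear q hq (by have := hr.1.2.1; omega), by have := hr.1.2.1; omega⟩ hqR)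
    (by
      intro r hr q hq hqR hcq ho hk
      have hrx := hr.1.2.1
      refine absurd ⟨?_, by omega⟩ hqR
      by_cases h : c q + 1 < x p
      · exact hnear q hq h
      · have hltr := M.lt r hr.1.1
        have hltq := M.lt q hq
        have hynq := M.yn q hq
        have n1 := M.nc p hp q hq
        have n2 := M.nc q hq p hp
        have := M.rule hq
        refine ⟨hq, ?_⟩
        unfold OnV at ho
        unfold prio at hk
        split_ifs at hk <;> omega)
    (c r) r ⟨hrR, by omega⟩ rfl
  have hpQ : p ∉ Q := fun h => by
    have := (hQ p h).1.1.2.1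
    omega
  have hd := M.dense (insert p Q) (Finset.insert_subset hp hQP) (Finset.insert_nonempty _ _)
  have hsub : ((insert p Q).biUnion fun p => vset n (x p) (y p)) ⊆
      insert (x p) (((Q.biUnion fun p => vset n (x p) (y p)).filter (· ≤ c r)) ∪
        {n - 1, n - 2}) := by
    intro w hw
    rw [Finset.mem_insert, Finset.mem_union, Finset.mem_filter, Finset.mem_insert,
      Finset.mem_singleton]
    rw [Finset.biUnion_insert, Finset.mem_union, mem_vset (by omega) (by omega)] at hw
    rcases hw with hw | hw
    · by_cases hwr : w = c r
      · subst hwr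
        refine Or.inr (Or.inl ⟨Finset.mem_biUnion.2 ⟨r, hrQ, ?_⟩, le_rfl⟩)
        rw [mem_vset (by omega) hynr]
        exact M.onV hr
      · unfold OnV at hw
        omega
    · by_cases hwr : w ≤ c r
      · exact Or.inr (Or.inl ⟨hw, hwr⟩)
      · obtain ⟨q, hqQ, hqw⟩ := Finset.mem_biUnion.1 hw
        have hltq := M.lt q (hQP hqQ)
        have hynq := M.yn q (hQP hqQ)
        rw [mem_vset (by omega) hynq] at hqw
        obtain ⟨h3, h4⟩ := (hQ q hqQ).1.1.2
        unfold OnV at hqw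
        omega
  have h1 := Finset.card_le_card hsub
  have h2 := Finset.card_insert_le (x p)
    (((Q.biUnion fun p => vset n (x p) (y p)).filter (· ≤ c r)) ∪ {n - 1, n - 2})
  rw [Finset.card_insert_of_notMem hpQ] at hd
  omega


/-- The position of a propagator along its edge ending at position `u`. -/
def endKey (n x y u : ℕ) : ℕ := if x = u then y - x else x + n - y

/-- `p` and `q` are consecutive, in counterclockwise order, on the edge ending at position `u`. -/
structure Consec (n : ℕ) (P : Finset ι) (x y : ι → ℕ) (u : ℕ) (p q : ι) : Prop where
  left_mem : p ∈ P
  right_mem : q ∈ P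
  left_on : x p = u ∨ y p = u
  right_on : x q = u ∨ y q = u
  lt : endKey n (x q) (y q) u < endKey n (x p) (y p) u
  not_between : ∀ r ∈ P, (x r = u ∨ y r = u) →
    ¬ (endKey n (x q) (y q) u < endKey n (x r) (y r) u ∧
      endKey n (x r) (y r) u < endKey n (x p) (y p) u)

theorem prio_self {u x y : ℕ} (hu : x = u ∨ y = u) (h : x < y) :
    prio n x y u = n + endKey n x y u := by
  unfold prio endKey; split_ifs <;> omega

theorem prio_pred {u x y w : ℕ} (hu : x = u ∨ y = u) (h : x + 2 ≤ y) (hw : w + 1 = u) (hn : y < n) :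
    prio n x y w = endKey n x y u := by
  unfold prio endKey; split_ifs <;> omega

theorem endKey_inj (M : LinModel n P x y c) {u : ℕ} {p q : ι} (hp : p ∈ P) (hq : q ∈ P)
    (hpu : x p = u ∨ y p = u) (hqu : x q = u ∨ y q = u)
    (h : endKey n (x p) (y p) u = endKey n (x q) (y q) u) : p = q := by
  have h1 := M.lt p hp
  have h2 := M.lt q hq
  have h3 := M.yn p hp
  have h4 := M.yn q hq
  unfold endKey at h
  apply M.inj p hp q hq <;> split_ifs at h <;> omega

/-- If the first of two consecutive propagators on an edge contributes the first vertex of the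
edge, then the second one contributes the second vertex. -/
theorem Consec.c_right (M : LinModel n P x y c) {u : ℕ} {p q : ι} (h : Consec n P x y u p q)
    (hc : c p + 1 = u) : c q = u := by
  obtain ⟨hp, hq, hpu, hqu, hk, hb⟩ := h
  have lp := M.lt p hp
  have lq := M.lt q hq
  have yp := M.yn p hp
  have yq := M.yn q hq
  have hne : p ≠ q := by rintro rfl; omega
  have rq := M.rule hq
  have hcne : c p ≠ c q := fun h => hne (M.c_injective hp hq h)
  rcases hqu with hqu | hqu
  · by_contra hcon
    obtain ⟨s, hs, hcs, hos, hks⟩ := M.c_occ q hq u (by unfold OnV; omega) (by omega) (by omega)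
    have ls := M.lt s hs
    have ys := M.yn s hs
    have hsu : x s = u ∨ y s = u := by
      unfold OnV at hos; unfold prio at hks; split_ifs at hks <;> omega
    have hks' : endKey n (x q) (y q) u < endKey n (x s) (y s) u := by
      unfold prio at hks; unfold endKey; split_ifs at hks ⊢ <;> omega
    have h1 := hb s hs hsu
    have h2 : endKey n (x s) (y s) u ≠ endKey n (x p) (y p) u := fun h => by
      have := M.endKey_inj hs hp hsu hpu h
      subst this; omega
    have := M.lt_of_prio hp hs (by omega) (by unfold OnV; omega)
      (by
        have h3 : endKey n (x p) (y p) u < endKey n (x s) (y s) u := by omega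
        unfold endKey at h3; unfold prio; split_ifs at h3 ⊢ <;> omega)
    omega
  · have hpy : y p = u := by unfold endKey at hk; split_ifs at hk <;> omega
    obtain ⟨s, hs, hcs, hos, hks⟩ := M.c_occ p hp (x p) (by unfold OnV; omega) (by omega)
      (by omega)
    have ls := M.lt s hs
    have ys := M.yn s hs
    have rs := M.rule hs
    have := M.nc q hq s hs
    unfold prio at hks; unfold endKey at hk
    split_ifs at hks hk <;> omega

/-- If the second of two consecutive propagators on an edge contributes the second vertex of the
edge, then the first one contributes the first vertex. -/
theorem Consec.c_left (M : LinModel n P x y c) {u : ℕ} {p q : ι} (h : Consec n P x y u p q)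
    (hc : c q = u) : c p + 1 = u := by
  obtain ⟨hp, hq, hpu, hqu, hk, hb⟩ := h
  have lp := M.lt p hp
  have lq := M.lt q hq
  have yp := M.yn p hp
  have yq := M.yn q hq
  have rq := M.rule hq
  have rp := M.rule hp
  have hxq : x q = u := by omega
  have := M.lt_of_prio hq hp (by omega) (by unfold OnV; omega)
    (by unfold endKey at hk; unfold prio; split_ifs at hk ⊢ <;> omega)
  by_contra hcon
  have hyp : y p = u := by omega
  obtain ⟨s, hs, hcs, hos, hks⟩ := M.c_occ q hq (u - 1) (by unfold OnV; omega) (by omega)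
    (by omega)
  have ls := M.lt s hs
  have ys := M.yn s hs
  have rs := M.rule hs
  have hsp : s ≠ p := by rintro rfl; omega
  by_cases hsu : x s = u ∨ y s = u
  · have h1 := hb s hs hsu
    have h2 : endKey n (x s) (y s) u ≠ endKey n (x p) (y p) u := fun h =>
      hsp (M.endKey_inj hs hp hsu hpu h)
    rw [prio_pred (u := u) (Or.inl hxq) lq (by omega) yq,
      prio_pred (u := u) hsu ls (by omega) ys] at hks
    have hin : Inside x y p s := by
      have h3 : endKey n (x p) (y p) u < endKey n (x s) (y s) u := by omega
      unfold Inside; unfold endKey at h3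
      split_ifs at h3 <;> omega
    have := M.lt_of_inside p hp s hs hin
    omega
  · have := M.nc p hp s hs
    unfold prio at hks
    split_ifs at hks <;> omega

/-- A propagator not strictly inside `r` can only meet the vertex contributed by a propagator
strictly inside `r` at the second vertex of the first edge of `r`. -/
theorem eq_of_not_inside (M : LinModel n P x y c) {r t u : ι} (hr : r ∈ P) (ht : t ∈ P)
    (hu : u ∈ P) (hin : Inside x y r t) (hout : ¬ Inside x y r u)
    (ho : OnV n (x u) (y u) (c t)) : c t = x r ∧ c r + 1 = x r := by
  have h1 := M.lt_of_inside r hr t ht hin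
  have lr := M.lt r hr
  have lt := M.lt t ht
  have lu := M.lt u hu
  have yr := M.yn r hr
  have yt := M.yn t ht
  have yu := M.yn u hu
  have rr := M.rule hr
  have rt := M.rule ht
  have n1 := M.nc r hr u hu
  have n2 := M.nc u hu r hr
  have hne : r ≠ t := by rintro rfl; unfold Inside at hin; omega
  have hcne : c r ≠ c t := fun h => hne (M.c_injective hr ht h)
  have hx : c t ≤ x r := by unfold Inside at hin hout; unfold OnV at ho; omega
  have hxt : c t = x r := by
    by_contra hcon
    have := M.lt_of_prio ht hr (by omega) (by unfold Inside at hin; unfold OnV; omega)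
      (by unfold Inside at hin; unfold prio; split_ifs <;> omega)
    unfold Inside at hin; omega
  refine ⟨hxt, ?_⟩
  by_contra hcon
  obtain ⟨s, hs, hcs, hos, hks⟩ := M.c_occ r hr (x r) (by unfold OnV; omega) (by omega)
    (by omega)
  have := M.c_injective hs ht (by omega)
  subst this
  unfold Inside at hin; unfold prio at hks
  split_ifs at hks <;> omega

/-- A propagator with less priority than `w` at the second vertex of the first edge of `w` lies
inside `w` or ends at the next edge. -/
theorem inside_of_prio_lt (M : LinModel n P x y c) {w z : ι} (hw : w ∈ P) (hz : z ∈ P)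
    (ho : OnV n (x z) (y z) (x w))
    (hk : prio n (x z) (y z) (x w) < prio n (x w) (y w) (x w)) :
    Inside x y w z ∨ y z = x w + 1 := by
  have lw := M.lt w hw
  have lz := M.lt z hz
  have yw := M.yn w hw
  have yz := M.yn z hz
  have n3 := M.nc w hw z hz
  rw [prio_self (Or.inl rfl) (by omega), endKey, if_pos rfl] at hk
  unfold Inside; unfold OnV at ho; unfold prio at hk; split_ifs at hk <;> omega

theorem _root_.WLD.exists_not_and_of_sameCycle {κ : Type*} [Finite κ] {π : Equiv.Perm κ}
    {A : κ → Prop} {a b : κ} (h : π.SameCycle a b) (ha : ¬ A a) (hb : A b) :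
    ∃ u, ¬ A u ∧ A (π u) := by
  by_contra! hcon
  obtain ⟨k, -, -, hk⟩ := h.exists_pow_eq''
  have : ∀ k : ℕ, ¬ A ((π ^ k) a) := by
    intro k
    induction k with
    | zero => simpa using ha
    | succ k ih =>
      rw [pow_succ', Equiv.Perm.mul_apply]
      exact hcon _ ih
  exact this k (hk ▸ hb)

/-- A permutation contributing to the determinant on the vertices of the necklace only swaps
propagators contributing the two vertices of a common edge. -/
theorem perm_pair (M : LinModel n P x y c) {T : Finset ι} (hT : T ⊆ P) (π : Equiv.Perm ↥T)
    (hπ : ∀ t : ↥T, OnV n (x t) (y t) (c (π t))) (t : ↥T) :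
    π t = t ∨ (∃ a b : ↥T, π a = b ∧ π b = a ∧ (t = a ∨ t = b) ∧ c b = c a + 1 ∧
      (x a = c b ∨ y a = c b) ∧ (x b = c b ∨ y b = c b)) := by
  have hP : ∀ t : ↥T, (t : ι) ∈ P := fun t => hT t.2
  obtain ⟨p, hpt, hmin⟩ := (Finset.univ.filter fun s : ↥T => π.SameCycle t s).exists_min_image
    (fun s => c s) ⟨t, by simpa using Equiv.Perm.SameCycle.refl π t⟩
  simp only [Finset.mem_filter, Finset.mem_univ, true_and] at hpt hmin
  have enter : ∀ (r : ι) (z : ↥T), r ∈ P → π.SameCycle p z → ¬ Inside x y r p →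
      Inside x y r z → c r + 1 = x r := by
    intro r z hr hz hp hz'
    obtain ⟨u, hu, hu'⟩ := exists_not_and_of_sameCycle (A := fun s : ↥T => Inside x y r s)
      hz hp hz'
    exact (M.eq_of_not_inside hr (hP _) (hP _) hu' hu (hπ u)).2
  by_cases hfix : π p = p
  · left
    have : ∀ k : ℕ, (π ^ k) p = p := by
      intro k
      induction k with
      | zero => rfl
      | succ k ih => rw [pow_succ', Equiv.Perm.mul_apply, ih, hfix]
    obtain ⟨k, -, -, hk⟩ := hpt.symm.exists_pow_eq''
    rw [this k] at hk
    rw [← hk, hfix]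
  right
  obtain ⟨w, hw⟩ := π.surjective p
  have hwp : w ≠ p := by rintro rfl; exact hfix hw
  have hpw : π.SameCycle p w := by
    rw [← hw]; exact (Equiv.Perm.sameCycle_apply_left.2 (Equiv.Perm.SameCycle.refl _ _))
  have hcne : c p ≠ c w := fun h => hwp (Subtype.ext (M.c_injective (hP _) (hP _) h)).symm
  have hcpw : c p < c w := by
    have := hmin w (hpt.trans hpw); omega
  have ho : OnV n (x w) (y w) (c p) := by have := hπ w; rwa [hw] at this
  have take : ∀ a b : ↥T, OnV n (x b) (y b) (c a) → c a < c b →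
      prio n (x b) (y b) (c a) < prio n (x a) (y a) (c a) := by
    intro a b h1 h2
    obtain ⟨q, hq, hcq, -, hk⟩ := M.c_occ b (hP b) (c a) h1 h2 (M.lt_n (hP a))
    rwa [M.c_injective hq (hP a) hcq] at hk
  have lp := M.lt p (hP p)
  have lw := M.lt w (hP w)
  have yp := M.yn p (hP p)
  have yw := M.yn w (hP w)
  have rp := M.rule (hP p)
  have rw' := M.rule (hP w)
  have op := M.onV (hP p)
  have hk := take p w ho hcpw
  have n1 := M.nc p (hP p) w (hP w)
  have n2 := M.nc w (hP w) p (hP p)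
  have hnp : ¬ Inside x y p p := by unfold Inside; omega
  have hv : c p + 1 = x w := by
    by_contra hcon
    have : Inside x y p w := by
      unfold Inside; unfold OnV at ho; unfold prio at hk; split_ifs at hk <;> omega
    have := enter p w (hP p) hpw hnp this
    unfold OnV at ho; unfold prio at hk; split_ifs at hk <;> omega
  have hpw' : y p = x w ∨ (x p = x w ∧ y w < y p) := by
    by_contra hcon
    have hxp : x p = c p ∧ y w ≤ y p := by
      unfold OnV at op; unfold prio at hk; split_ifs at hk <;> omega
    have : Inside x y p w := by unfold Inside; omega
    have := enter p w (hP p) hpw hnp this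
    omega
  have hcw : c w = x w := by
    by_contra hcon
    obtain ⟨z, hz, hcz, hoz, hkz⟩ := M.c_occ w (hP w) (x w) (by unfold OnV; omega) (by omega)
      (by omega)
    have lz := M.lt z hz
    have yz := M.yn z hz
    have rz := M.rule hz
    have hxz : x z = x w ∧ y w < y z := by
      unfold prio at hkz; split_ifs at hkz <;> omega
    have hin : Inside x y z w := by unfold Inside; omega
    have hout : ¬ Inside x y z p := by
      intro h
      have := M.lt_of_prio (hP p) hz (by omega) (by unfold OnV; omega)
        (by unfold Inside at h; unfold prio; split_ifs <;> omega)
      omega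
    have := enter z w hz hpw hout hin
    omega
  obtain ⟨z, hzw⟩ := π.surjective w
  have hzp : z = p := by
    by_contra hcon
    have hzw' : z ≠ w := by rintro rfl; exact hwp (hzw.symm.trans hw)
    have hpz : π.SameCycle p z := hpw.trans (by
      rw [← hzw]; exact Equiv.Perm.sameCycle_apply_left.2 (Equiv.Perm.SameCycle.refl _ _))
    have h1 : c z ≠ c p := fun h => hcon (Subtype.ext (M.c_injective (hP _) (hP _) h))
    have h2 : c z ≠ c w := fun h => hzw' (Subtype.ext (M.c_injective (hP _) (hP _) h))
    have h3 := hmin z (hpt.trans hpz)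
    have hoz : OnV n (x z) (y z) (c w) := by have := hπ z; rwa [hzw] at this
    have hkz := take w z hoz (by omega)
    have lz := M.lt z (hP z)
    have yz := M.yn z (hP z)
    have rz := M.rule (hP z)
    rw [hcw] at hoz hkz
    have hin : Inside x y w z :=
      (M.inside_of_prio_lt (hP w) (hP z) hoz hkz).resolve_right (by omega)
    have := enter w z (hP w) hpz (by unfold Inside; omega) hin
    omega
  subst hzp
  refine ⟨z, w, hzw, hw, ?_, by omega, by omega, by omega⟩
  have : ∀ k : ℕ, (π ^ k) z = z ∨ (π ^ k) z = w := by
    intro k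
    induction k with
    | zero => simp
    | succ k ih =>
      rw [pow_succ', Equiv.Perm.mul_apply]
      rcases ih with h | h <;> simp [h, hw, hzw]
  obtain ⟨k, -, -, hk⟩ := hpt.symm.exists_pow_eq''
  rw [← hk]
  exact this k

/-- Two propagators contributing the two vertices of an edge that both have an end on are
consecutive on that edge. -/
theorem consec_of_c (M : LinModel n P x y c) {a b : ι} {u : ℕ} (ha : a ∈ P) (hb : b ∈ P)
    (hcb : c b = u) (hca : c a + 1 = u) (hau : x a = u ∨ y a = u) (hbu : x b = u ∨ y b = u) :
    Consec n P x y u a b := by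
  have la := M.lt a ha
  have lb := M.lt b hb
  have ya := M.yn a ha
  have yb := M.yn b hb
  have hkey : endKey n (x b) (y b) u < endKey n (x a) (y a) u := by
    by_contra hcon
    have hne : endKey n (x b) (y b) u ≠ endKey n (x a) (y a) u := fun h => by
      have := M.endKey_inj hb ha hbu hau h
      subst this; omega
    have := M.lt_of_prio ha hb (by omega) (by unfold OnV; omega)
      (by rw [prio_pred hau la hca ya, prio_pred hbu lb hca yb]; omega)
    omega
  obtain ⟨q, hq, hmax⟩ := (P.filter fun q => (x q = u ∨ y q = u) ∧
    endKey n (x q) (y q) u < endKey n (x a) (y a) u).exists_max_image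
    (fun q => endKey n (x q) (y q) u) ⟨b, by simp [hb, hbu, hkey]⟩
  simp only [Finset.mem_filter] at hq hmax
  have hcon : Consec n P x y u a q := by
    refine ⟨ha, hq.1, hau, hq.2.1, hq.2.2, fun r hr hru h => ?_⟩
    have := hmax r ⟨hr, hru, h.2⟩
    omega
  have := hcon.c_right M hca
  rwa [M.c_injective hb hq.1 (hcb.trans this.symm)]

end LinModel
end WLD

namespace WLD
variable {n : ℕ} {P : Finset (Prp n)}

theorem ord_self (i : ZMod n) : ord n i i = 0 := by simp [ord]

theorem ord_lt [NeZero n] (i v : ZMod n) : ord n i v < n := ZMod.val_lt _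

theorem ord_injective [NeZero n] (i : ZMod n) : Function.Injective (ord n i) := fun _ _ h =>
  sub_left_injective (ZMod.val_injective n h)

theorem add_ord [NeZero n] (i v : ZMod n) : i + (ord n i v : ZMod n) = v := by
  simp [ord]

theorem ord_add_natCast [NeZero n] (i : ZMod n) {t : ℕ} (ht : t < n) : ord n i (i + t) = t := by
  simp [ord, ZMod.val_natCast_of_lt ht]

theorem ord_succ [NeZero n] (i v : ZMod n) :
    (ord n i v + 1 < n ∧ ord n i (v + 1) = ord n i v + 1) ∨
      (ord n i v + 1 = n ∧ ord n i (v + 1) = 0) := by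
  have h := ord_lt i v
  have h1 : v + 1 = i + ((ord n i v + 1 : ℕ) : ZMod n) := by
    push_cast; rw [← add_assoc, add_ord]
  rcases Nat.lt_or_ge (ord n i v + 1) n with h2 | h2
  · exact Or.inl ⟨h2, by rw [h1, ord_add_natCast i h2]⟩
  · have h3 : ord n i v + 1 = n := by omega
    refine Or.inr ⟨h3, ?_⟩
    rw [h1, h3]; simp [ord]

theorem ord_eq_sub [NeZero n] (i e f : ZMod n) :
    (ord n i e ≤ ord n i f ∧ ord n e f = ord n i f - ord n i e) ∨
      (ord n i f < ord n i e ∧ ord n e f = ord n i f + n - ord n i e) := by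
  have h1 := ord_lt i e
  have h2 := ord_lt i f
  rcases Nat.lt_or_ge (ord n i f) (ord n i e) with h | h
  · refine Or.inr ⟨h, ?_⟩
    have : f = e + ((ord n i f + n - ord n i e : ℕ) : ZMod n) := by
      rw [Nat.cast_sub (by omega)]
      push_cast
      rw [ZMod.natCast_self, add_zero]
      have := add_ord i e
      have := add_ord i f
      linear_combination add_ord i e - add_ord i f
    conv_lhs => rw [this]
    exact ord_add_natCast e (by omega)
  · refine Or.inl ⟨h, ?_⟩
    have : f = e + ((ord n i f - ord n i e : ℕ) : ZMod n) := by
      rw [Nat.cast_sub h]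
      linear_combination add_ord i e - add_ord i f
    conv_lhs => rw [this]
    exact ord_add_natCast e (by omega)

theorem ord_add_one_add_one (e f : ZMod n) : ord n (e + 1) (f + 1) = ord n e f := by
  simp [ord]

/-- The position, from the starting vertex `i`, of the second vertex of the first edge met by a
propagator. -/
def firstEnd (i : ZMod n) (p : Prp n) : ℕ :=
  Sym2.lift ⟨fun a b => min (ord n i (a + 1)) (ord n i (b + 1)), fun _ _ => min_comm _ _⟩ p

/-- The position, from the starting vertex `i`, of the second vertex of the last edge met by a
propagator. -/
def lastEnd (i : ZMod n) (p : Prp n) : ℕ :=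
  Sym2.lift ⟨fun a b => max (ord n i (a + 1)) (ord n i (b + 1)), fun _ _ => max_comm _ _⟩ p

/-- The position, from the starting vertex `i`, of the vertex contributed by a propagator. -/
noncomputable def contrib (P : Finset (Prp n)) (i : ZMod n) (p : Prp n) : ℕ :=
  (gnAssign n P i p).elim n (ord n i)

theorem firstEnd_mk (i a b : ZMod n) :
    firstEnd i s(a, b) = min (ord n i (a + 1)) (ord n i (b + 1)) := rfl

theorem lastEnd_mk (i a b : ZMod n) :
    lastEnd i s(a, b) = max (ord n i (a + 1)) (ord n i (b + 1)) := rfl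

theorem exists_rep (i : ZMod n) (p : Prp n) :
    ∃ a b, p = s(a, b) ∧ firstEnd i p = ord n i (a + 1) ∧ lastEnd i p = ord n i (b + 1) ∧
      ord n i (a + 1) ≤ ord n i (b + 1) := by
  induction p using Sym2.ind with
  | _ a b =>
    rw [firstEnd_mk, lastEnd_mk]
    rcases le_total (ord n i (a + 1)) (ord n i (b + 1)) with h | h
    · exact ⟨a, b, rfl, by omega, by omega, h⟩
    · exact ⟨b, a, Sym2.eq_swap, by omega, by omega, h⟩

theorem mem_supp_mk {a b v : ZMod n} :
    v ∈ supp n s(a, b) ↔ v = a ∨ v = a + 1 ∨ v = b ∨ v = b + 1 := by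
  simp [supp]

theorem mem_prp_iff [NeZero n] (i : ZMod n) {p : Prp n} {e : ZMod n} :
    e ∈ p ↔ firstEnd i p = ord n i (e + 1) ∨ lastEnd i p = ord n i (e + 1) := by
  obtain ⟨a, b, rfl, ha, hb, -⟩ := exists_rep i p
  rw [ha, hb, (ord_injective i).eq_iff, (ord_injective i).eq_iff, add_left_inj, add_left_inj,
    Sym2.mem_iff, eq_comm, @eq_comm _ e b]

theorem mem_supp_iff_mem {p : Prp n} {v : ZMod n} : v ∈ supp n p ↔ v ∈ p ∨ v - 1 ∈ p := by
  induction p using Sym2.ind with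
  | _ a b =>
    rw [mem_supp_mk, Sym2.mem_iff, Sym2.mem_iff, sub_eq_iff_eq_add, sub_eq_iff_eq_add]
    tauto

theorem mem_supp_iff [NeZero n] (i : ZMod n) {p : Prp n} {v : ZMod n} :
    v ∈ supp n p ↔ OnV n (firstEnd i p) (lastEnd i p) (ord n i v) := by
  obtain ⟨a, b, rfl, ha, hb, hab⟩ := exists_rep i p
  rw [mem_supp_mk, ha, hb, ← (ord_injective i).eq_iff, ← (ord_injective i).eq_iff,
    ← (ord_injective i).eq_iff (a := v) (b := b), ← (ord_injective i).eq_iff (a := v) (b := b + 1)]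
  have h1 := ord_succ i a
  have h2 := ord_succ i b
  have := ord_lt i v
  unfold OnV
  omega

theorem otherEnd_mk {a b : ZMod n} : otherEnd n s(a, b) a = b := by
  unfold otherEnd
  rw [dif_pos (Sym2.mem_mk_left a b)]
  exact Sym2.congr_right.1 (Sym2.other_spec _)

theorem edgeKey_eq [NeZero n] (i : ZMod n) {p : Prp n} {e : ZMod n}
    (h : firstEnd i p < lastEnd i p) (he : e ∈ p) :
    edgeKey n e p = LinModel.endKey n (firstEnd i p) (lastEnd i p) (ord n i (e + 1)) := by
  obtain ⟨a, b, rfl, ha, hb, hab⟩ := exists_rep i p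
  rw [ha, hb] at h ⊢
  have hk := ord_eq_sub i (a + 1) (b + 1)
  have hk' := ord_eq_sub i (b + 1) (a + 1)
  rw [ord_add_one_add_one] at hk hk'
  unfold edgeKey LinModel.endKey
  rcases Sym2.mem_iff.1 he with rfl | rfl
  · rw [otherEnd_mk, if_pos rfl]; omega
  · rw [Sym2.eq_swap, otherEnd_mk, if_neg (by omega)]; omega

theorem cwKey_eq [NeZero n] (i : ZMod n) {p : Prp n} {v : ZMod n}
    (h : firstEnd i p + 2 ≤ lastEnd i p) (hv : v ∈ supp n p) :
    cwKey n v p = prio n (firstEnd i p) (lastEnd i p) (ord n i v) := by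
  have hon := (mem_supp_iff i).1 hv
  have e1 := mem_prp_iff i (p := p) (e := v - 1)
  have e2 := mem_prp_iff i (p := p) (e := v)
  have h0 := ord_succ i v
  have hl : lastEnd i p < n := by
    obtain ⟨a, b, rfl, ha, hb, hab⟩ := exists_rep i p
    rw [hb]; exact ord_lt _ _
  rw [sub_add_cancel] at e1
  unfold cwKey
  split_ifs with hc
  · have := edgeKey_eq i (by omega) hc
    unfold edgeKey at this
    rw [this, sub_add_cancel, LinModel.prio_self (e1.1 hc) (by omega)]
  · have hv' := (mem_supp_iff_mem.1 hv).resolve_right hc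
    have := edgeKey_eq i (by omega) hv'
    unfold edgeKey at this
    rw [this]
    rw [e1] at hc
    rw [e2] at hv'
    unfold prio LinModel.endKey
    split_ifs <;> omega

/-- The properties of the state of the necklace algorithm after the first `t` steps. -/
structure RunSpec (P : Finset (Prp n)) (i : ZMod n) (t : ℕ) (R : Finset (Prp n))
    (f : Prp n → Option (ZMod n)) : Prop where
  sub : R ⊆ P
  eq_none : ∀ p ∈ R, f p = none
  eq_some : ∀ p ∈ P, p ∉ R → ∃ s < t, f p = some (i + (s : ZMod n)) ∧ i + (s : ZMod n) ∈ supp n p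
  mem : ∀ p v, f p = some v → p ∈ P ∧ p ∉ R
  inj : ∀ p q v, f p = some v → f q = some v → p = q
  occ : ∀ p ∈ P, ∀ s < t, i + (s : ZMod n) ∈ supp n p → (∀ r ≤ s, f p ≠ some (i + (r : ZMod n))) →
    ∃ q ∈ P, f q = some (i + (s : ZMod n)) ∧ i + (s : ZMod n) ∈ supp n q ∧
      cwKey n (i + (s : ZMod n)) p ≤ cwKey n (i + (s : ZMod n)) q

theorem pickCW_none {S : Finset (Prp n)} {a : ZMod n} (h : pickCW n S a = none) :
    ∀ p ∈ S, a ∉ supp n p := by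
  unfold pickCW at h
  split_ifs at h with h'
  intro p hp ha
  exact h' ⟨p, Finset.mem_filter.2 ⟨hp, ha⟩⟩

theorem pickCW_some {S : Finset (Prp n)} {a : ZMod n} {p : Prp n} (h : pickCW n S a = some p) :
    p ∈ S ∧ a ∈ supp n p ∧ ∀ q ∈ S, a ∈ supp n q → cwKey n a q ≤ cwKey n a p := by
  unfold pickCW at h
  split_ifs at h with h'
  have hs := Classical.choose_spec
    ((S.filter fun p => a ∈ supp n p).exists_max_image (cwKey n a) h')
  rw [Option.some_inj] at h
  rw [h] at hs
  simp only [Finset.mem_filter] at hs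
  exact ⟨hs.1.1, hs.1.2, fun q hq hq' => hs.2 q ⟨hq, hq'⟩⟩

theorem natCast_add_injective [NeZero n] {i : ZMod n} {s t : ℕ} (hs : s < n) (ht : t < n)
    (h : i + (s : ZMod n) = i + (t : ZMod n)) : s = t := by
  rw [← ord_add_natCast i hs, h, ord_add_natCast i ht]

theorem runSpec_gnRun [NeZero n] (P : Finset (Prp n)) (i : ZMod n) :
    ∀ t ≤ n, RunSpec P i t (gnRun n P i t).1 (gnRun n P i t).2 := by
  intro t
  induction t with
  | zero =>
    intro _
    refine ⟨subset_rfl, fun _ _ => rfl, fun p hp hp' => absurd hp hp', ?_, ?_, ?_⟩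
    · intro p v h; simp [gnRun] at h
    · intro p q v h; simp [gnRun] at h
    · intro p hp s hs; omega
  | succ t ih =>
    intro ht
    have H := ih (by omega)
    rw [gnRun]
    cases hpick : pickCW n (gnRun n P i t).1 (i + (t : ZMod n)) with
    | none =>
      dsimp only
      have hno := pickCW_none hpick
      refine ⟨H.sub, H.eq_none, fun p hp hp' => ?_, H.mem, H.inj, fun p hp s hs hsp hf => ?_⟩
      · obtain ⟨s, hs, h⟩ := H.eq_some p hp hp'
        exact ⟨s, by omega, h⟩
      · rcases Nat.lt_succ_iff_lt_or_eq.1 hs with hs | rfl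
        · exact H.occ p hp s hs hsp hf
        · exfalso
          by_cases hpR : p ∈ (gnRun n P i s).1
          · exact hno p hpR hsp
          · obtain ⟨s', hs', h, -⟩ := H.eq_some p hp hpR
            exact hf s' (by omega) h
    | some p₀ =>
      obtain ⟨h0R, h0s, h0max⟩ := pickCW_some hpick
      have h0none := H.eq_none p₀ h0R
      have hold : ∀ q v, (gnRun n P i t).2 q = some v →
          Function.update (gnRun n P i t).2 p₀ (some (i + (t : ZMod n))) q = some v := by
        intro q v h
        rw [Function.update_of_ne, h]
        rintro rfl
        rw [h0none] at h; simp at h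
      have hval : ∀ q v, (gnRun n P i t).2 q = some v → v ≠ i + (t : ZMod n) := by
        rintro q v h rfl
        obtain ⟨hq, hqR⟩ := H.mem q _ h
        obtain ⟨s, hs, h', -⟩ := H.eq_some q hq hqR
        rw [h] at h'
        have := natCast_add_injective (by omega) (by omega) (Option.some_inj.1 h')
        omega
      dsimp only
      refine ⟨(Finset.erase_subset _ _).trans H.sub, ?_, ?_, ?_, ?_, ?_⟩
      · intro p hp
        rw [Function.update_of_ne (Finset.ne_of_mem_erase hp)]
        exact H.eq_none p (Finset.mem_of_mem_erase hp)
      · intro p hp hpR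
        by_cases h : p = p₀
        · subst h
          exact ⟨t, by omega, by simp, h0s⟩
        · obtain ⟨s, hs, h1, h2⟩ := H.eq_some p hp fun h' => hpR (Finset.mem_erase.2 ⟨h, h'⟩)
          exact ⟨s, by omega, hold p _ h1, h2⟩
      · intro p v h
        by_cases hp : p = p₀
        · subst hp
          exact ⟨H.sub h0R, Finset.notMem_erase _ _⟩
        · rw [Function.update_of_ne hp] at h
          obtain ⟨h1, h2⟩ := H.mem p v h
          exact ⟨h1, fun h' => h2 (Finset.mem_of_mem_erase h')⟩
      · intro p q v h1 h2
        by_cases hp : p = p₀ <;> by_cases hq : q = p₀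
        · rw [hp, hq]
        · subst hp
          rw [Function.update_self] at h1
          rw [Function.update_of_ne hq] at h2
          exact absurd (Option.some_inj.1 h1).symm (hval q v h2)
        · subst hq
          rw [Function.update_self] at h2
          rw [Function.update_of_ne hp] at h1
          exact absurd (Option.some_inj.1 h2).symm (hval p v h1)
        · rw [Function.update_of_ne hp] at h1
          rw [Function.update_of_ne hq] at h2
          exact H.inj p q v h1 h2
      · intro p hp s hs hsp hf
        have hf' : ∀ r ≤ s, (gnRun n P i t).2 p ≠ some (i + (r : ZMod n)) := fun r hr h =>
          hf r hr (hold p _ h)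
        rcases Nat.lt_succ_iff_lt_or_eq.1 hs with hs | rfl
        · obtain ⟨q, hq, h1, h2⟩ := H.occ p hp s hs hsp hf'
          exact ⟨q, hq, hold q _ h1, h2⟩
        · refine ⟨p₀, H.sub h0R, by simp, h0s, ?_⟩
          by_cases hpR : p ∈ (gnRun n P i s).1
          · exact h0max p hpR hsp
          · obtain ⟨s', hs', h, -⟩ := H.eq_some p hp hpR
            exact absurd h (hf' s' (by omega))

theorem linModel [NeZero n] (hP : IsAdmissible n P) (i : ZMod n) :
    LinModel n P (firstEnd i) (lastEnd i) (contrib P i) := by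
  have hlast : ∀ p : Prp n, lastEnd i p < n := by
    intro p
    obtain ⟨a, b, rfl, ha, hb, hab⟩ := exists_rep i p
    rw [hb]; exact ord_lt _ _
  have hsep : ∀ p ∈ P, firstEnd i p + 2 ≤ lastEnd i p ∧
      (firstEnd i p = 0 → lastEnd i p + 1 < n) := by
    intro p hp
    have hd := hP.dense {p} (by simpa using hp) (by simp)
    rw [suppSet, Finset.singleton_biUnion, Finset.card_singleton] at hd
    have hlp := hlast p
    obtain ⟨a, b, rfl, ha, hb, hab⟩ := exists_rep i p
    have h3 : ∀ u v w : ZMod n, ¬ ∀ z, z ∈ supp n s(a, b) → z = u ∨ z = v ∨ z = w := by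
      intro u v w h
      have hsub : supp n s(a, b) ⊆ {u, v, w} := fun z hz => by simpa using h z hz
      have h1 := Finset.card_le_card hsub
      have h2 := Finset.card_le_three (a := u) (b := v) (c := w)
      omega
    simp only [mem_supp_mk] at h3
    have n1 : a + 1 ≠ b + 1 := by
      rintro h
      refine h3 a (a + 1) b ?_
      rw [h]; tauto
    have n2 : a + 1 + 1 ≠ b + 1 := by
      intro h
      refine h3 a (a + 1) (b + 1) ?_
      rw [← add_right_cancel h]; tauto
    have n3 : b + 1 + 1 ≠ a + 1 := by
      intro h
      refine h3 b (b + 1) (a + 1) ?_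
      rw [← add_right_cancel h]; tauto
    rw [ne_eq, ← (ord_injective i).eq_iff] at n1 n2 n3
    have h1 := ord_succ i (a + 1)
    have h2 := ord_succ i (b + 1)
    omega
  have hmem : ∀ p ∈ P, ∀ v, gnAssign n P i p = some v → v ∈ supp n p := by
    intro p hp v h
    have H := runSpec_gnRun P i n le_rfl
    obtain ⟨s, hs, h1, h2⟩ := H.eq_some p hp (H.mem p v h).2
    unfold gnAssign at h
    rw [h, Option.some_inj] at h1
    rwa [h1]
  have hsome : ∀ p, contrib P i p < n →
      ∃ v, gnAssign n P i p = some v ∧ contrib P i p = ord n i v := by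
    intro p h
    unfold contrib at h ⊢
    cases hg : gnAssign n P i p with
    | none => rw [hg] at h; simp at h
    | some v => exact ⟨v, rfl, rfl⟩
  constructor
  · exact fun p hp => (hsep p hp).1
  · exact fun p hp => hlast p
  · exact fun p hp => (hsep p hp).2
  · intro p hp q hq h1 h2
    obtain ⟨a, b, rfl, ha, hb, hab⟩ := exists_rep i p
    obtain ⟨a', b', rfl, ha', hb', hab'⟩ := exists_rep i q
    rw [ha, ha'] at h1
    rw [hb, hb'] at h2
    rw [add_right_cancel (ord_injective i h1), add_right_cancel (ord_injective i h2)]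
  · rintro p hp q hq ⟨h1, h2, h3⟩
    refine hP.noncross p hp q hq ?_
    obtain ⟨a, b, rfl, ha, hb, hab⟩ := exists_rep i p
    obtain ⟨a', b', rfl, ha', hb', hab'⟩ := exists_rep i q
    refine ⟨a, b, a', b', rfl, rfl, ?_⟩
    have k1 := ord_eq_sub i (a + 1) (a' + 1)
    have k2 := ord_eq_sub i (a + 1) (b + 1)
    have k3 := ord_eq_sub i (a + 1) (b' + 1)
    rw [ord_add_one_add_one] at k1 k2 k3
    omega
  · intro Q hQ hQn
    have : (Q.biUnion fun p => vset n (firstEnd i p) (lastEnd i p)) =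
        (suppSet n Q).image (ord n i) := by
      ext w
      simp only [Finset.mem_biUnion, Finset.mem_image, suppSet]
      constructor
      · rintro ⟨p, hp, hw⟩
        have := hsep p (hQ hp)
        have := hlast p
        rw [mem_vset (by omega) (by omega)] at hw
        have hwn : w < n := by unfold OnV at hw; omega
        refine ⟨i + w, ⟨p, hp, ?_⟩, ord_add_natCast i hwn⟩
        rw [mem_supp_iff i, ord_add_natCast i hwn]
        exact hw
      · rintro ⟨v, ⟨p, hp, hv⟩, rfl⟩
        refine ⟨p, hp, ?_⟩
        have := hsep p (hQ hp)
        have := hlast p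
        rw [mem_vset (by omega) (by omega), ← mem_supp_iff i]
        exact hv
    rw [this, Finset.card_image_of_injective _ (ord_injective i)]
    exact hP.dense Q hQ hQn
  · intro p hp h
    obtain ⟨v, hv, hc⟩ := hsome p h
    rw [hc, ← mem_supp_iff i]
    exact hmem p hp v hv
  · intro p hp q hq h hn
    obtain ⟨v, hv, hc⟩ := hsome p hn
    obtain ⟨v', hv', hc'⟩ := hsome q (by omega)
    rw [hc, hc'] at h
    rw [← ord_injective i h] at hv'
    exact (runSpec_gnRun P i n le_rfl).inj p q v hv hv'
  · intro p hp w hw hlt hn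
    have hws : i + (w : ZMod n) ∈ supp n p := by
      rwa [mem_supp_iff i, ord_add_natCast i hn]
    obtain ⟨q, hq, h1, h2, h3⟩ := (runSpec_gnRun P i n le_rfl).occ p hp w hn hws (by
      intro r hr h
      have : contrib P i p = ord n i (i + (r : ZMod n)) := by
        unfold contrib gnAssign; rw [h]; rfl
      rw [ord_add_natCast i (by omega)] at this
      omega)
    have hcq : contrib P i q = w := by
      have : contrib P i q = ord n i (i + (w : ZMod n)) := by
        unfold contrib gnAssign; rw [h1]; rfl
      rw [this, ord_add_natCast i hn]
    refine ⟨q, hq, hcq, ?_, ?_⟩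
    · rwa [mem_supp_iff i, ord_add_natCast i hn] at h2
    · rw [cwKey_eq i (hsep p hp).1 hws, cwKey_eq i (hsep q hq).1 h2, ord_add_natCast i hn] at h3
      refine lt_of_le_of_ne h3 fun h => ?_
      rw [mem_supp_iff i, ord_add_natCast i hn] at h2
      obtain ⟨e1, e2⟩ := prio_inj (by have := hsep p hp; omega) (hlast p)
        (by have := hsep q hq; omega) (hlast q) hw h2 h
      have : p = q := by
        obtain ⟨a, b, rfl, ha, hb, hab⟩ := exists_rep i p
        obtain ⟨a', b', rfl, ha', hb', hab'⟩ := exists_rep i q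
        rw [ha, ha'] at e1
        rw [hb, hb'] at e2
        rw [add_right_cancel (ord_injective i e1), add_right_cancel (ord_injective i e2)]
      subst this
      omega


theorem firstEnd_of_lt {i a b : ZMod n} (h : ord n i (a + 1) < ord n i (b + 1)) :
    firstEnd i s(a, b) = ord n i (a + 1) := by rw [firstEnd_mk]; omega

theorem lastEnd_of_lt {i a b : ZMod n} (h : ord n i (a + 1) < ord n i (b + 1)) :
    lastEnd i s(a, b) = ord n i (b + 1) := by rw [lastEnd_mk]; omega

theorem eq_of_ord_add_one [NeZero n] {i v a : ZMod n} (h : ord n i v + 1 = ord n i (a + 1)) :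
    v = a := by
  have h1 := ord_succ i v
  have h2 := ord_lt i (a + 1)
  exact add_right_cancel (ord_injective i (show ord n i (v + 1) = ord n i (a + 1) by omega))

theorem ord_ne_of_ne [NeZero n] (i : ZMod n) {a b : ZMod n} (h : a ≠ b) : ord n i a ≠ ord n i b :=
  fun h' => h (ord_injective i h')

theorem gnAssign_eq [NeZero n] (hP : IsAdmissible n P) (i : ZMod n) {p : Prp n} (hp : p ∈ P) :
    gnAssign n P i p = some (colOf n P i p) := by
  have := (linModel hP i).lt_n hp
  unfold contrib at this
  unfold colOf
  cases h : gnAssign n P i p with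
  | none => rw [h] at this; simp at this
  | some v => rfl

theorem contrib_eq [NeZero n] (hP : IsAdmissible n P) (i : ZMod n) {p : Prp n} (hp : p ∈ P) :
    contrib P i p = ord n i (colOf n P i p) := by
  unfold contrib; rw [gnAssign_eq hP i hp]; rfl

theorem colOf_mem_supp [NeZero n] (hP : IsAdmissible n P) (i : ZMod n) {p : Prp n} (hp : p ∈ P) :
    colOf n P i p ∈ supp n p := by
  rw [mem_supp_iff i, ← contrib_eq hP i hp]
  exact (linModel hP i).onV hp

theorem colOf_injOn [NeZero n] (hP : IsAdmissible n P) (i : ZMod n) {p q : Prp n} (hp : p ∈ P)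
    (hq : q ∈ P) (h : colOf n P i p = colOf n P i q) : p = q := by
  refine (linModel hP i).c_injective hp hq ?_
  rw [contrib_eq hP i hp, contrib_eq hP i hq, h]

theorem ends_ne [NeZero n] (hP : IsAdmissible n P) {a b : ZMod n} (hp : s(a, b) ∈ P) :
    a ≠ b ∧ a + 1 ≠ b ∧ b + 1 ≠ a ∧ a + 1 ≠ a ∧ b + 1 ≠ b := by
  have hn := hP.card_add_four_le
  have M := linModel hP 0
  have h1 := M.lt _ hp
  have h2 := M.yn _ hp
  have h3 := M.wrap _ hp
  rw [firstEnd_mk, lastEnd_mk] at h1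
  rw [lastEnd_mk] at h2
  rw [firstEnd_mk, lastEnd_mk] at h3
  have h4 := ord_succ 0 (a + 1)
  have h5 := ord_succ 0 (b + 1)
  refine ⟨?_, ?_, ?_, ?_, ?_⟩
  · rintro rfl; omega
  · rintro rfl; omega
  · rintro rfl; omega
  · intro h
    have := ord_succ 0 a
    rw [h] at this; omega
  · intro h
    have := ord_succ 0 b
    rw [h] at this; omega

theorem ord_end_ne [NeZero n] (hP : IsAdmissible n P) (i : ZMod n) {a b : ZMod n}
    (hp : s(a, b) ∈ P) : ord n i (a + 1) ≠ ord n i (b + 1) :=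
  ord_ne_of_ne i fun h => (ends_ne hP hp).1 (add_right_cancel h)

theorem colOf_rule [NeZero n] (hP : IsAdmissible n P) {i a b : ZMod n} (hp : s(a, b) ∈ P)
    (h : ord n i (a + 1) < ord n i (b + 1)) :
    (colOf n P i s(a, b) = a ∧ a + 1 ≠ i) ∨ colOf n P i s(a, b) = a + 1 ∨
      colOf n P i s(a, b) = b := by
  have := (linModel hP i).rule hp
  rw [contrib_eq hP i hp, firstEnd_of_lt h, lastEnd_of_lt h] at this
  rcases this with h1 | h1 | h1
  · refine Or.inl ⟨eq_of_ord_add_one h1, ?_⟩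
    rintro rfl
    rw [ord_self] at h1; omega
  · exact Or.inr (Or.inl (ord_injective i h1))
  · exact Or.inr (Or.inr (eq_of_ord_add_one h1))

theorem lt_of_colOf_eq [NeZero n] (hP : IsAdmissible n P) {i a b : ZMod n} (hp : s(a, b) ∈ P)
    (h : colOf n P i s(a, b) = a + 1) : ord n i (a + 1) < ord n i (b + 1) := by
  by_contra hcon
  have h1 := ord_end_ne hP i hp
  obtain ⟨n1, n2, n3, n4, n5⟩ := ends_ne hP hp
  have hp' := hp
  rw [Sym2.eq_swap] at hp' h
  have := colOf_rule hP hp' (i := i) (by omega)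
  rw [h] at this
  rcases this with h | h | h
  · exact n2 h.1
  · exact n1 (add_right_cancel h)
  · exact n4 h

theorem ord_pred [NeZero n] (a : ZMod n) (h : 1 < n) : ord n (a + 1) a = n - 1 := by
  have h1 := ord_succ (a + 1) a
  rw [ord_self] at h1
  omega

theorem colOf_add_two [NeZero n] (hP : IsAdmissible n P) {a b : ZMod n} (hp : s(a, b) ∈ P) :
    colOf n P (b + 2) s(a, b) = a := by
  have hn := hP.card_add_four_le
  have hb : ord n (b + 2) (b + 1) = n - 1 := by
    rw [show b + 2 = (b + 1) + 1 by ring]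
    exact ord_pred _ (by omega)
  have h := ord_end_ne hP (b + 2) hp
  have h1 := ord_lt (b + 2) (a + 1)
  have h2 : ord n (b + 2) (a + 1) < ord n (b + 2) (b + 1) := by omega
  have := (linModel hP (b + 2)).eq_first_of_last hp (by rw [lastEnd_of_lt h2]; omega)
  rw [contrib_eq hP _ hp, firstEnd_of_lt h2] at this
  exact eq_of_ord_add_one this

theorem exists_taken [NeZero n] (hP : IsAdmissible n P) {i v : ZMod n} {p : Prp n} (hp : p ∈ P)
    (hv : v ∈ supp n p) (h : ord n i v < ord n i (colOf n P i p)) :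
    ∃ q ∈ P, colOf n P i q = v ∧ v ∈ supp n q ∧ cwKey n v p < cwKey n v q := by
  have M := linModel hP i
  obtain ⟨q, hq, h1, h2, h3⟩ := M.c_occ p hp _ ((mem_supp_iff i).1 hv)
    (by rwa [contrib_eq hP i hp]) (ord_lt i v)
  rw [← mem_supp_iff] at h2
  refine ⟨q, hq, ?_, h2, ?_⟩
  · rw [contrib_eq hP i hq] at h1
    exact ord_injective i h1
  · rwa [cwKey_eq i (M.lt p hp) hv, cwKey_eq i (M.lt q hq) h2]

theorem ord_colOf_lt [NeZero n] (hP : IsAdmissible n P) {i : ZMod n} {p q : Prp n} (hp : p ∈ P)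
    (hq : q ∈ P) (hv : colOf n P i p ∈ supp n q)
    (h : cwKey n (colOf n P i p) p < cwKey n (colOf n P i p) q) :
    ord n i (colOf n P i q) < ord n i (colOf n P i p) := by
  have M := linModel hP i
  rw [cwKey_eq i (M.lt p hp) (colOf_mem_supp hP i hp), cwKey_eq i (M.lt q hq) hv,
    ← contrib_eq hP i hp] at h
  rw [mem_supp_iff i, ← contrib_eq hP i hp] at hv
  rw [← contrib_eq hP i hp, ← contrib_eq hP i hq]
  exact M.lt_of_prio hp hq (M.lt_n hp) hv h

theorem ord_succ_start [NeZero n] (i v : ZMod n) :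
    (ord n i v = 0 ∧ v = i ∧ ord n (i + 1) v + 1 = n) ∨
      (ord n i v = ord n (i + 1) v + 1 ∧ ord n (i + 1) v + 1 < n) := by
  have h := ord_succ (i + 1) v
  rw [ord_add_one_add_one] at h
  rcases h with h | h
  · exact Or.inr ⟨h.2, h.1⟩
  · refine Or.inl ⟨h.2, ?_, h.1⟩
    have := add_ord i v
    rw [h.2] at this
    simpa using this.symm

/-- Advancing the starting vertex never moves a contributed vertex backwards. -/
theorem ord_colOf_le [NeZero n] (hP : IsAdmissible n P) (i : ZMod n) :
    ∀ p ∈ P, ord n i (colOf n P i p) ≤ ord n (i + 1) (colOf n P (i + 1) p) + 1 := by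
  suffices ∀ m, ∀ p ∈ P, ord n (i + 1) (colOf n P (i + 1) p) = m →
      ord n i (colOf n P i p) ≤ m + 1 from fun p hp => this _ p hp rfl
  intro m
  induction m using Nat.strong_induction_on with
  | _ m ih =>
  intro p hp hm
  by_contra hcon
  have h1 := ord_succ_start i (colOf n P (i + 1) p)
  have h2 := ord_lt i (colOf n P i p)
  have h3 := ord_lt (i + 1) (colOf n P (i + 1) p)
  have hlt : ord n i (colOf n P (i + 1) p) < ord n i (colOf n P i p) := by omega
  obtain ⟨q, hq, hcq, hvq, hk⟩ := exists_taken hP hp (colOf_mem_supp hP (i + 1) hp) hlt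
  have h4 := ord_colOf_lt hP hp hq hvq hk
  have h5 := ih _ (by omega) q hq rfl
  rw [hcq] at h5
  omega

theorem cwKey_succ_of_mem {a b : ZMod n} :
    cwKey n (a + 1) s(a, b) = n + ord n a b := by
  unfold cwKey
  rw [add_sub_cancel_right, if_pos (Sym2.mem_mk_left a b), otherEnd_mk]

/-- Advancing the starting vertex does not move a contributed vertex past the second vertex of
the first edge. -/
theorem colOf_no_skip [NeZero n] (hP : IsAdmissible n P) {i a b : ZMod n} (hp : s(a, b) ∈ P)
    (h : ord n i (a + 1) < ord n i (b + 1)) (hia : a + 1 ≠ i) (h1 : colOf n P i s(a, b) = a)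
    (h2 : colOf n P (i + 1) s(a, b) = b) : False := by
  obtain ⟨n1, n2, n3, n4, n5⟩ := ends_ne hP hp
  have hn := hP.card_add_four_le
  have e1 := ord_succ_start i (a + 1)
  have e2 := ord_succ_start i b
  have e3 := ord_succ i b
  have e4 := ord_ne_of_ne i n2
  have hib : i ≠ b := by
    rintro rfl
    have := ord_succ i a
    rw [ord_self] at *
    omega
  obtain ⟨s, hs, hcs, hsv, hk⟩ := exists_taken hP hp (i := i + 1) (v := a + 1)
    (by rw [mem_supp_mk]; tauto) (by
      rw [h2]
      have : ord n i b ≠ 0 := fun h => hib.symm (ord_injective i (h.trans (ord_self i).symm))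
      have : ord n i (a + 1) ≠ 0 := fun h => hia (ord_injective i (h.trans (ord_self i).symm))
      omega)
  have has : a ∈ s := by
    by_contra hcon
    rw [cwKey_succ_of_mem] at hk
    unfold cwKey at hk
    rw [add_sub_cancel_right, if_neg hcon] at hk
    have := ord_lt (a + 1) (otherEnd n s (a + 1))
    omega
  obtain ⟨d, rfl⟩ := Sym2.mem_iff_exists.1 has
  rw [cwKey_succ_of_mem, cwKey_succ_of_mem] at hk
  have hkey : ∀ d, s(a, d) ∈ P → cwKey n a s(a, d) = ord n a d := by
    intro d hd
    obtain ⟨n1, n2, n3, n4, n5⟩ := ends_ne hP hd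
    unfold cwKey
    rw [if_neg, otherEnd_mk]
    rw [Sym2.mem_iff]
    rintro (h | h)
    · exact n4 (sub_eq_iff_eq_add.1 h).symm
    · exact n3 (sub_eq_iff_eq_add.1 h).symm
  have h3 := ord_colOf_lt hP hp hs (by rw [h1, mem_supp_mk]; tauto)
    (by rw [h1, hkey _ hp, hkey _ hs]; omega)
  rw [h1] at h3
  have h4 := lt_of_colOf_eq hP hs hcs
  have e5 := ord_succ_start i (d + 1)
  have e6 := ord_succ i a
  have h5 : d + 1 ≠ i := by
    rintro rfl
    have := colOf_add_two hP hs
    rw [show d + 1 + 1 = d + 2 by ring, this] at hcs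
    exact n4 hcs.symm
  have h6 : ord n i (d + 1) ≠ 0 := fun h => h5 (ord_injective i (h.trans (ord_self i).symm))
  have h7 : ord n i (a + 1) ≠ 0 := fun h => hia (ord_injective i (h.trans (ord_self i).symm))
  have e7 := ord_succ i d
  have h8 := ord_ne_of_ne i (ends_ne hP hs).1
  have := colOf_rule hP hs (i := i) (by omega)
  rcases this with h | h | h
  · rw [h.1] at h3; omega
  · rw [h] at h3; omega
  · rw [h] at h3; omega

/-- The possible moves of a contributed vertex while the starting vertex travels from one end of
a propagator to the other. -/
theorem colOf_step [NeZero n] (hP : IsAdmissible n P) {i a b : ZMod n} (hp : s(a, b) ∈ P)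
    (h : ord n i (a + 1) < ord n i (b + 1)) :
    (colOf n P i s(a, b) = a ∧ colOf n P (i + 1) s(a, b) = a) ∨
    (colOf n P i s(a, b) = a ∧ colOf n P (i + 1) s(a, b) = a + 1) ∨
    (colOf n P i s(a, b) = a + 1 ∧ colOf n P (i + 1) s(a, b) = a + 1) ∨
    (colOf n P i s(a, b) = a + 1 ∧ colOf n P (i + 1) s(a, b) = b) ∨
    (colOf n P i s(a, b) = b ∧ colOf n P (i + 1) s(a, b) = b) := by
  obtain ⟨n1, n2, n3, n4, n5⟩ := ends_ne hP hp
  have h0 := colOf_rule hP hp h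
  by_cases hia : a + 1 = i
  · have : colOf n P (i + 1) s(a, b) = b := by
      rw [← hia, Sym2.eq_swap, show a + 1 + 1 = a + 2 by ring]
      exact colOf_add_two hP (by rwa [Sym2.eq_swap])
    tauto
  · have hia' : ord n i (a + 1) ≠ 0 := fun h => hia (ord_injective i (h.trans (ord_self i).symm))
    have e1 := ord_succ_start i (a + 1)
    have e2 := ord_succ_start i (b + 1)
    have h1 := colOf_rule hP hp (i := i + 1) (by omega)
    have hm := ord_colOf_le hP i _ hp
    have hns := colOf_no_skip hP hp h hia
    have f1 : ord n i a + 1 = ord n i (a + 1) := by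
      have := ord_succ i a; omega
    have f2 : ord n i b + 1 = ord n i (b + 1) := by
      have := ord_succ i b; omega
    have f3 : ord n i (a + 1) = ord n (i + 1) (a + 1) + 1 := by omega
    have f4 : a ≠ i → ord n i a = ord n (i + 1) a + 1 := by
      have := ord_succ_start i a; tauto
    have f5 : ord n i (a + 1) ≠ ord n i b := ord_ne_of_ne i n2
    rcases h0 with h0 | h0 | h0
    · rcases h1 with h1 | h1 | h1
      · exact Or.inl ⟨h0.1, h1.1⟩
      · exact Or.inr (Or.inl ⟨h0.1, h1⟩)
      · exact (hns h0.1 h1).elim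
    · rcases h1 with h1 | h1 | h1
      · have f4 := f4 fun h => h1.2 (by rw [h])
        rw [h0, h1.1] at hm; omega
      · exact Or.inr (Or.inr (Or.inl ⟨h0, h1⟩))
      · exact Or.inr (Or.inr (Or.inr (Or.inl ⟨h0, h1⟩)))
    · rcases h1 with h1 | h1 | h1
      · have f4 := f4 fun h => h1.2 (by rw [h])
        rw [h0, h1.1] at hm; omega
      · rw [h0, h1] at hm; omega
      · exact Or.inr (Or.inr (Or.inr (Or.inr ⟨h0, h1⟩)))

theorem prod_half_turn [NeZero n] (hP : IsAdmissible n P) {R : Type*} [CommMonoid R]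
    (G : ZMod n → R) {a b : ZMod n} (hp : s(a, b) ∈ P) :
    ∏ t ∈ Finset.range (ord n b a), (if colOf n P (b + 2 + (t : ZMod n)) s(a, b) ≠
      colOf n P (b + 2 + (t : ZMod n) + 1) s(a, b) then
        G (colOf n P (b + 2 + (t : ZMod n) + 1) s(a, b)) else 1) =
      G (a + 1) * G b := by
  obtain ⟨n1, n2, n3, n4, n5⟩ := ends_ne hP hp
  have hn := hP.card_add_four_le
  have key : ∀ t ≤ ord n b a, ∀ Q, ∏ t ∈ Finset.range t, (if colOf n P (b + 2 + (t : ZMod n)) s(a, b) ≠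
      colOf n P (b + 2 + (t : ZMod n) + 1) s(a, b) then G (colOf n P (b + 2 + (t : ZMod n) + 1) s(a, b)) else 1) = Q →
      (colOf n P (b + 2 + (t : ZMod n)) s(a, b) = a ∧ Q = 1) ∨
      (colOf n P (b + 2 + (t : ZMod n)) s(a, b) = a + 1 ∧ Q = G (a + 1)) ∨
      (colOf n P (b + 2 + (t : ZMod n)) s(a, b) = b ∧ Q = G (a + 1) * G b) := by
    intro t
    induction t with
    | zero =>
      rintro - Q rfl
      left
      simpa using colOf_add_two hP hp
    | succ t ih =>
      rintro ht Q rfl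
      have hord : ord n (b + 2 + (t : ZMod n)) (a + 1) < ord n (b + 2 + (t : ZMod n)) (b + 1) := by
        have e1 := ord_eq_sub (b + 1) (b + 2 + (t : ZMod n)) (a + 1)
        have e2 := ord_eq_sub (b + 1) (b + 2 + (t : ZMod n)) (b + 1)
        have e3 : ord n (b + 1) (b + 2 + (t : ZMod n)) = t + 1 := by
          have : ord n b a < n := ord_lt _ _
          rw [show b + 2 + (t : ZMod n) = b + 1 + ((t + 1 : ℕ) : ZMod n) by push_cast; ring]
          exact ord_add_natCast _ (by omega)
        rw [ord_self, e3] at e2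
        rw [ord_add_one_add_one, e3] at e1
        have := ord_lt b a
        omega
      have := colOf_step hP hp hord
      have ih := ih (by omega) _ rfl
      rw [Finset.prod_range_succ]
      rw [show b + 2 + ((t + 1 : ℕ) : ZMod n) = b + 2 + t + 1 by push_cast; ring]
      rcases this with ⟨h1, h2⟩ | ⟨h1, h2⟩ | ⟨h1, h2⟩ | ⟨h1, h2⟩ | ⟨h1, h2⟩ <;>
        rw [h1] at ih <;> simp only [h1, h2]
      · left
        simpa [n1, n2.symm, n4.symm, n4] using ih
      · right; left
        rcases ih with ih | ih | ih
        · refine ⟨trivial, ?_⟩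
          rw [ih.2]
          simp [n4.symm]
        · exact absurd ih.1.symm n4
        · exact absurd ih.1 n1
      · right; left
        simpa [n1, n2, n4.symm, n4] using ih
      · right; right
        rcases ih with ih | ih | ih
        · exact absurd ih.1 n4
        · refine ⟨trivial, ?_⟩
          rw [ih.2]
          simp [n2]
        · exact absurd ih.1 n2
      · right; right
        simpa [n1.symm, n2.symm] using ih
  have := key _ le_rfl _ rfl
  have hlast : colOf n P (b + 2 + (ord n b a : ZMod n)) s(a, b) = b := by
    rw [show b + 2 + (ord n b a : ZMod n) = a + 2 by
      linear_combination add_ord b a]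
    rw [Sym2.eq_swap]
    exact colOf_add_two hP (by rwa [Sym2.eq_swap])
  rw [hlast] at this
  rcases this with h | h | h
  · exact absurd h.1.symm n1
  · exact absurd h.1.symm n2
  · exact h.2

theorem prod_univ_eq_prod_range [NeZero n] {R : Type*} [CommMonoid R] (f : ZMod n → R)
    (i : ZMod n) : ∏ j, f j = ∏ t ∈ Finset.range n, f (i + t) := by
  symm
  refine Finset.prod_bij (fun t _ => i + (t : ZMod n)) (fun _ _ => Finset.mem_univ _) ?_ ?_
    (fun _ _ => rfl)
  · intro s hs t ht h
    exact natCast_add_injective (Finset.mem_range.1 hs) (Finset.mem_range.1 ht) h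
  · intro j _
    exact ⟨ord n i j, Finset.mem_range.2 (ord_lt i j), add_ord i j⟩

/-- In a full turn of the starting vertex, a propagator newly contributes each vertex of its
support exactly once. -/
theorem prod_full_turn [NeZero n] (hP : IsAdmissible n P) {R : Type*} [CommMonoid R]
    (G : ZMod n → R) {a b : ZMod n} (hp : s(a, b) ∈ P) :
    ∏ i : ZMod n, (if colOf n P (i - 1) s(a, b) ≠ colOf n P i s(a, b) then
      G (colOf n P i s(a, b)) else 1) = G a * G (a + 1) * (G b * G (b + 1)) := by
  obtain ⟨n1, -⟩ := ends_ne hP hp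
  have hsum : ord n b a + ord n a b = n := by
    have h1 := ord_eq_sub b a b
    have h2 := ord_ne_of_ne b n1
    have h3 := ord_lt b a
    rw [ord_self] at h1 h2
    omega
  rw [prod_univ_eq_prod_range _ (b + 3), show Finset.range n =
    Finset.range (ord n b a + ord n a b) by rw [hsum], Finset.prod_range_add]
  have hp' : s(b, a) ∈ P := by rwa [Sym2.eq_swap]
  have h1 := prod_half_turn hP G hp
  have h2 := prod_half_turn hP G hp'
  rw [Sym2.eq_swap] at h2
  have e1 : ∀ t : ℕ, b + 3 + (t : ZMod n) - 1 = b + 2 + t := fun t => by ring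
  have e2 : ∀ t : ℕ, b + 3 + (t : ZMod n) = b + 2 + t + 1 := fun t => by ring
  have e3 : ∀ t : ℕ, b + 3 + ((ord n b a + t : ℕ) : ZMod n) = a + 2 + t + 1 := fun t => by
    push_cast; linear_combination add_ord b a
  simp only [e3, add_sub_cancel_right, e1]
  simp only [e2]
  rw [h1, h2, mul_comm (G (a + 1)), mul_mul_mul_comm, mul_comm (G b * _), ← mul_assoc,
    mul_assoc, mul_comm (G a)]


theorem det_of_pair {κ R : Type*} [Fintype κ] [DecidableEq κ] [CommRing R] (A : Matrix κ κ R)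
    {p q : κ} (hpq : p ≠ q) (h : ∀ t, t = p ∨ t = q) :
    A.det = A p p * A q q - A p q * A q p := by
  have hbij : Function.Bijective (![p, q] : Fin 2 → κ) := by
    constructor
    · intro s t hst
      fin_cases s <;> fin_cases t <;> simp_all [eq_comm]
    · intro t
      rcases h t with rfl | rfl
      · exact ⟨0, rfl⟩
      · exact ⟨1, rfl⟩
  rw [← Matrix.det_submatrix_equiv_self (Equiv.ofBijective _ hbij), Matrix.det_fin_two]
  simp

/-- A determinant in which only the permutations preserving `b` contribute, where the fibers of
`b` have one or two elements. -/
theorem det_eq_prod_of_fibers {κ R α : Type*} [Fintype κ] [DecidableEq κ] [CommRing R]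
    [LinearOrder α] (A : Matrix κ κ R) (b : κ → α) (g : κ → R)
    (hperm : ∀ π : Equiv.Perm κ, (∀ t, A (π t) t ≠ 0) → ∀ t, b (π t) = b t)
    (hfib : ∀ s, (∃ p, (∀ t, b t = b s ↔ t = p) ∧ A p p = g p) ∨
      ∃ p q, p ≠ q ∧ (∀ t, b t = b s ↔ t = p ∨ t = q) ∧
        A p p * A q q - A p q * A q p = g p * g q) :
    A.det = ∏ t, g t := by
  have hdet : A.det = (Matrix.of fun s t => if b s = b t then A s t else 0).det := by
    rw [Matrix.det_apply, Matrix.det_apply]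
    refine Finset.sum_congr rfl fun π _ => ?_
    congr 1
    by_cases hπ : ∀ t, A (π t) t ≠ 0
    · exact Finset.prod_congr rfl fun t _ => by simp [hperm π hπ t]
    · push Not at hπ
      obtain ⟨t, ht⟩ := hπ
      rw [Finset.prod_eq_zero (f := fun s => A (π s) s) (Finset.mem_univ t) ht,
        Finset.prod_eq_zero (Finset.mem_univ t)]
      simp [ht]
  have htri : (Matrix.of fun s t => if b s = b t then A s t else 0).BlockTriangular b :=
    fun s t hst => by simp [hst.ne']
  rw [hdet, htri.det, ← Finset.prod_fiberwise_of_maps_to (g := b) (t := Finset.univ.image b)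
    (fun t _ => Finset.mem_image_of_mem b (Finset.mem_univ t))]
  refine Finset.prod_congr rfl fun k hk => ?_
  obtain ⟨s, -, rfl⟩ := Finset.mem_image.1 hk
  rcases hfib s with ⟨p, hp, hA⟩ | ⟨p, q, hpq, hp, hA⟩
  · have : Finset.univ.filter (fun t => b t = b s) = {p} := by
      ext t; simp [hp]
    rw [this, Finset.prod_singleton, ← hA]
    have : Subsingleton {t // b t = b s} :=
      ⟨fun u v => Subtype.ext (((hp u).1 u.2).trans ((hp v).1 v.2).symm)⟩
    rw [Matrix.det_eq_elem_of_subsingleton _ ⟨p, (hp p).2 rfl⟩]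
    simp [Matrix.toSquareBlock_def]
  · have : Finset.univ.filter (fun t => b t = b s) = {p, q} := by
      ext t; simp [hp]
    rw [this, Finset.prod_pair hpq, ← hA]
    have hbp : b p = b s := (hp p).2 (Or.inl rfl)
    have hbq : b q = b s := (hp q).2 (Or.inr rfl)
    rw [det_of_pair (p := ⟨p, hbp⟩) (q := ⟨q, hbq⟩) _ (by simpa using hpq)
      (fun t => by simpa [Subtype.ext_iff] using (hp t).1 t.2)]
    simp [Matrix.toSquareBlock_def, hbp, hbq]

theorem firstEnd_lt_lastEnd [NeZero n] (hP : IsAdmissible n P) (i : ZMod n) {p : Prp n}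
    (hp : p ∈ P) : firstEnd i p + 2 ≤ lastEnd i p := (linModel hP i).lt p hp

theorem consecOnEdge_iff [NeZero n] (hP : IsAdmissible n P) (i : ZMod n) {e : ZMod n}
    {p q : Prp n} : ConsecOnEdge n P e p q ↔
      LinModel.Consec n P (firstEnd i) (lastEnd i) (ord n i (e + 1)) p q := by
  have hk : ∀ r ∈ P, e ∈ r → edgeKey n e r =
      LinModel.endKey n (firstEnd i r) (lastEnd i r) (ord n i (e + 1)) := fun r hr he =>
    edgeKey_eq i (by have := firstEnd_lt_lastEnd hP i hr; omega) he
  unfold ConsecOnEdge onEdge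
  simp only [Finset.mem_filter]
  constructor
  · rintro ⟨⟨hp, hpe⟩, ⟨hq, hqe⟩, hlt, hb⟩
    refine ⟨hp, hq, (mem_prp_iff i).1 hpe, (mem_prp_iff i).1 hqe, ?_, fun r hr hre => ?_⟩
    · rwa [← hk p hp hpe, ← hk q hq hqe]
    · have hre := (mem_prp_iff i).2 hre
      rw [← hk p hp hpe, ← hk q hq hqe, ← hk r hr hre]
      exact hb r ⟨hr, hre⟩
  · rintro ⟨hp, hq, hpe, hqe, hlt, hb⟩
    have hpe' := (mem_prp_iff i).2 hpe
    have hqe' := (mem_prp_iff i).2 hqe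
    refine ⟨⟨hp, hpe'⟩, ⟨hq, hqe'⟩, ?_, fun r hr => ?_⟩
    · rwa [hk p hp hpe', hk q hq hqe']
    · rw [hk p hp hpe', hk q hq hqe', hk r hr.1 hr.2]
      exact hb r hr.1 ((mem_prp_iff i).1 hr.2)

theorem ord_add_one_of_colOf [NeZero n] (hP : IsAdmissible n P) {i e : ZMod n} {p : Prp n}
    (hp : p ∈ P) (h : colOf n P i p = e) (he : e ∈ p) : ord n i (e + 1) = ord n i e + 1 := by
  rcases ord_succ i e with h1 | h1
  · exact h1.2
  · exfalso
    have hei : e + 1 = i := ord_injective i (h1.2.trans (ord_self i).symm)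
    obtain ⟨a, b, rfl, ha, hb, hle⟩ := exists_rep i p
    have hlt := lt_of_le_of_ne hle (ord_end_ne hP i hp)
    obtain ⟨n1, n2, n3, n4, n5⟩ := ends_ne hP hp
    rcases Sym2.mem_iff.1 he with rfl | rfl
    · rcases colOf_rule hP hp hlt with h2 | h2 | h2
      · exact h2.2 hei
      · exact n4 (h2.symm.trans h)
      · exact n1 (h.symm.trans h2)
    · omega

theorem colOf_right [NeZero n] (hP : IsAdmissible n P) {i e : ZMod n} {p q : Prp n}
    (h : ConsecOnEdge n P e p q) (hc : colOf n P i p = e) : colOf n P i q = e + 1 := by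
  have h' := (consecOnEdge_iff hP i).1 h
  have := h'.c_right (linModel hP i) (by
    rw [contrib_eq hP i h'.left_mem, hc]
    exact (ord_add_one_of_colOf hP h'.left_mem hc (Finset.mem_filter.1 h.1).2).symm)
  rw [contrib_eq hP i h'.right_mem] at this
  exact ord_injective i this

theorem colOf_left [NeZero n] (hP : IsAdmissible n P) {i e : ZMod n} {p q : Prp n}
    (h : ConsecOnEdge n P e p q) (hc : colOf n P i q = e + 1) : colOf n P i p = e := by
  have h' := (consecOnEdge_iff hP i).1 h
  have := h'.c_left (linModel hP i) (by rw [contrib_eq hP i h'.right_mem, hc])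
  rw [contrib_eq hP i h'.left_mem] at this
  exact eq_of_ord_add_one this

theorem colOf_left_iff [NeZero n] (hP : IsAdmissible n P) {i e : ZMod n} {p q : Prp n}
    (h : ConsecOnEdge n P e p q) : colOf n P i p = e ↔ colOf n P i q = e + 1 :=
  ⟨colOf_right hP h, colOf_left hP h⟩

theorem not_mem_sub_one [NeZero n] (hP : IsAdmissible n P) {v : ZMod n} {p : Prp n} (hp : p ∈ P)
    (hv : v ∈ p) : v - 1 ∉ p := by
  induction p using Sym2.ind with
  | _ a b =>
    obtain ⟨n1, n2, n3, n4, n5⟩ := ends_ne hP hp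
    intro h
    rw [Sym2.mem_iff] at h hv
    rcases hv with rfl | rfl <;> rcases h with h | h
    · exact n4 (by linear_combination -h)
    · exact n3 (by linear_combination -h)
    · exact n2 (by linear_combination -h)
    · exact n5 (by linear_combination -h)

/-- The factor of a minor due to the end of `p` on the edge `e`, at the vertex `e`: the minor
formed with the next propagator on the edge if there is one. -/
noncomputable def endFactor (P : Finset (Prp n)) (e : ZMod n) (p : Prp n) :
    MvPolynomial (Prp n × ZMod n) ℝ :=
  if h : ∃ q, ConsecOnEdge n P e p q then
    MvPolynomial.X (p, e) * MvPolynomial.X (h.choose, e + 1) -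
      MvPolynomial.X (h.choose, e) * MvPolynomial.X (p, e + 1)
  else MvPolynomial.X (p, e)

/-- The factor of a minor due to the end of `p` on the edge `e`, at the vertex `e + 1`. -/
noncomputable def endCofactor (P : Finset (Prp n)) (e : ZMod n) (p : Prp n) :
    MvPolynomial (Prp n × ZMod n) ℝ :=
  if ∃ q, ConsecOnEdge n P e q p then 1 else MvPolynomial.X (p, e + 1)

/-- The factor of a minor due to the propagator `p` contributing the vertex `v`. -/
noncomputable def colFactor (P : Finset (Prp n)) (p : Prp n) (v : ZMod n) :
    MvPolynomial (Prp n × ZMod n) ℝ :=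
  if v ∈ p then endFactor P v p else endCofactor P (v - 1) p

theorem edgeKey_injOn [NeZero n] (hP : IsAdmissible n P) {e : ZMod n} {p q : Prp n} (hp : p ∈ P)
    (hq : q ∈ P) (hpe : e ∈ p) (hqe : e ∈ q) (h : edgeKey n e p = edgeKey n e q) : p = q := by
  have hp' := firstEnd_lt_lastEnd hP 0 hp
  have hq' := firstEnd_lt_lastEnd hP 0 hq
  rw [edgeKey_eq 0 (by omega) hpe, edgeKey_eq 0 (by omega) hqe] at h
  exact (linModel hP 0).endKey_inj hp hq ((mem_prp_iff 0).1 hpe) ((mem_prp_iff 0).1 hqe) h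

theorem ConsecOnEdge.right_unique [NeZero n] (hP : IsAdmissible n P) {e : ZMod n}
    {p q r : Prp n} (h : ConsecOnEdge n P e p q) (h' : ConsecOnEdge n P e p r) : q = r := by
  obtain ⟨hp, hq, hlt, hb⟩ := h
  obtain ⟨-, hr, hlt', hb'⟩ := h'
  have h1 := hb r hr
  have h2 := hb' q hq
  simp only [onEdge, Finset.mem_filter] at hq hr
  exact edgeKey_injOn hP hq.1 hr.1 hq.2 hr.2 (by omega)

theorem ConsecOnEdge.left_mem {e : ZMod n} {p q : Prp n} (h : ConsecOnEdge n P e p q) :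
    p ∈ P ∧ e ∈ p := Finset.mem_filter.1 h.1

theorem ConsecOnEdge.right_mem {e : ZMod n} {p q : Prp n} (h : ConsecOnEdge n P e p q) :
    q ∈ P ∧ e ∈ q := Finset.mem_filter.1 h.2.1

theorem ConsecOnEdge.ne {e : ZMod n} {p q : Prp n} (h : ConsecOnEdge n P e p q) : p ≠ q := by
  rintro rfl; exact lt_irrefl _ h.2.2.1

theorem endFactor_of_consec [NeZero n] (hP : IsAdmissible n P) {e : ZMod n} {p q : Prp n}
    (h : ConsecOnEdge n P e p q) : endFactor P e p =
      MvPolynomial.X (p, e) * MvPolynomial.X (q, e + 1) -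
        MvPolynomial.X (q, e) * MvPolynomial.X (p, e + 1) := by
  have h' : ∃ q, ConsecOnEdge n P e p q := ⟨q, h⟩
  rw [endFactor, dif_pos h', h'.choose_spec.right_unique hP h]

theorem CW_of_mem {p : Prp n} {v : ZMod n} (h : v ∈ supp n p) :
    CW n p v = MvPolynomial.X (p, v) := if_pos h

/-- The vertex contributed by the first member of the pair of `p` if `p` is the second member of
a pair of consecutive propagators contributing the two vertices of an edge, and the vertex
contributed by `p` otherwise. -/
noncomputable def pairKey (P : Finset (Prp n)) (i : ZMod n) (p : Prp n) : ZMod n :=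
  if ∃ q, ConsecOnEdge n P (colOf n P i p - 1) q p then colOf n P i p - 1 else colOf n P i p

theorem pairKey_left [NeZero n] (hP : IsAdmissible n P) {i e : ZMod n} {p : Prp n} (hp : p ∈ P)
    (hc : colOf n P i p = e) (he : e ∈ p) : pairKey P i p = e := by
  rw [pairKey, hc, if_neg]
  rintro ⟨q, h⟩
  exact not_mem_sub_one hP hp he h.right_mem.2

theorem pairKey_right {i e : ZMod n} {p q : Prp n}
    (hc : colOf n P i q = e + 1) (h : ConsecOnEdge n P e p q) : pairKey P i q = e := by
  rw [pairKey, hc, add_sub_cancel_right, if_pos ⟨p, h⟩]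

theorem pairKey_eq_iff [NeZero n] (hP : IsAdmissible n P) (i : ZMod n) {p q : Prp n} (hp : p ∈ P)
    (hq : q ∈ P) (hcp : pairKey P i p = colOf n P i p) :
    pairKey P i q = pairKey P i p ↔ q = p ∨ ConsecOnEdge n P (colOf n P i p) p q := by
  constructor
  · intro h
    rw [hcp] at h
    unfold pairKey at h
    split_ifs at h with h1
    · right
      obtain ⟨r, hr⟩ := h1
      have hcr := colOf_left hP (i := i) hr (by ring)
      rw [h] at hcr hr
      rwa [colOf_injOn hP i hr.left_mem.1 hp hcr] at hr
    · exact Or.inl (colOf_injOn hP i hq hp h)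
  · rintro (rfl | h)
    · rfl
    · rw [hcp, pairKey_right (colOf_right hP h rfl) h]


theorem pairKey_perm [NeZero n] (hP : IsAdmissible n P) (i : ZMod n) {T : Finset (Prp n)}
    (hT : T ⊆ P) (π : Equiv.Perm ↥T)
    (hπ : ∀ t : ↥T, colOf n P i (π t) ∈ supp n (t : Prp n)) (t : ↥T) :
    pairKey P i (π t) = pairKey P i t := by
  have M := linModel hP i
  have := M.perm_pair hT π (fun t => by
    rw [contrib_eq hP i (hT (π t).2)]
    exact (mem_supp_iff i).1 (hπ t)) t
  rcases this with h | ⟨a, b, hab, hba, ht, hc, hau, hbu⟩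
  · rw [h]
  · have hcon : ConsecOnEdge n P (colOf n P i a) a b := by
      have h := M.consec_of_c (hT a.2) (hT b.2) rfl hc.symm hau hbu
      rw [contrib_eq hP i (hT a.2), contrib_eq hP i (hT b.2)] at hc
      have hv : ord n i (colOf n P i a + 1) = ord n i (colOf n P i b) := by
        have := ord_succ i (colOf n P i a)
        have := ord_lt i (colOf n P i b)
        omega
      rw [consecOnEdge_iff hP i, hv, ← contrib_eq hP i (hT b.2)]
      exact h
    have h1 := pairKey_left hP (i := i) (hT a.2) rfl hcon.left_mem.2
    have h2 := pairKey_right (colOf_right hP (i := i) hcon rfl) hcon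
    rcases ht with rfl | rfl
    · rw [hab, h1, h2]
    · rw [hba, h1, h2]

theorem det_eq_prod_colFactor [NeZero n] (hP : IsAdmissible n P) (i : ZMod n)
    {T : Finset (Prp n)} (hT : T ⊆ P)
    (hcl : ∀ p q, ConsecOnEdge n P (colOf n P i p) p q → (p ∈ T ↔ q ∈ T)) :
    (Matrix.of fun p q : ↥T => CW n (p : Prp n) (colOf n P i (q : Prp n))).det =
      ∏ p ∈ T, colFactor P p (colOf n P i p) := by
  rw [← Finset.prod_coe_sort]
  refine det_eq_prod_of_fibers _ (fun t : ↥T => ord n i (pairKey P i (t : Prp n))) _ ?_ ?_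
  · intro π hπ t
    have := pairKey_perm hP i hT π.symm (fun s => by
      by_contra hcon
      apply hπ (π.symm s)
      simp [CW, hcon]) (π t)
    rw [Equiv.symm_apply_apply] at this
    rw [this]
  · intro s
    have hlead : ∃ p : ↥T, pairKey P i (p : Prp n) = colOf n P i (p : Prp n) ∧
        pairKey P i (s : Prp n) = pairKey P i (p : Prp n) := by
      by_cases hs : ∃ q, ConsecOnEdge n P (colOf n P i s - 1) q s
      · obtain ⟨q, hq⟩ := hs
        have hcq := colOf_left hP (i := i) hq (by ring)
        have hkq := pairKey_left hP hq.left_mem.1 hcq hq.left_mem.2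
        refine ⟨⟨q, (hcl q s (by rwa [hcq])).2 s.2⟩, hkq.trans hcq.symm, ?_⟩
        rw [hkq, pairKey_right (by ring) hq]
      · exact ⟨s, if_neg hs, rfl⟩
    obtain ⟨p, hkp, hsp⟩ := hlead
    have hpP := hT p.2
    have hfib : ∀ t : ↥T, ord n i (pairKey P i (t : Prp n)) = ord n i (pairKey P i (s : Prp n)) ↔
        (t : Prp n) = p ∨ ConsecOnEdge n P (colOf n P i p) p t := fun t => by
      rw [(ord_injective i).eq_iff, hsp, pairKey_eq_iff hP i hpP (hT t.2) hkp]
    simp only [hfib]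
    by_cases hq : ∃ q, ConsecOnEdge n P (colOf n P i p) p q
    · right
      obtain ⟨q, hq⟩ := hq
      have hqT : q ∈ T := (hcl p q hq).1 p.2
      have hcq := colOf_right hP (i := i) hq rfl
      refine ⟨p, ⟨q, hqT⟩, fun h => hq.ne (congrArg Subtype.val h), fun t => ?_, ?_⟩
      · rw [Subtype.ext_iff, Subtype.ext_iff]
        refine or_congr_right ⟨fun h => h.right_unique hP hq, fun h => ?_⟩
        rw [h]; exact hq
      · have hmem := hq.left_mem.2
        have hmem' := hq.right_mem.2
        simp only [Matrix.of_apply, hcq]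
        rw [CW_of_mem (mem_supp_iff_mem.2 (Or.inl hmem)),
          CW_of_mem (mem_supp_iff_mem.2 (Or.inl hmem')),
          CW_of_mem (mem_supp_iff_mem.2 (Or.inr (by rwa [add_sub_cancel_right]))),
          CW_of_mem (mem_supp_iff_mem.2 (Or.inr (by rwa [add_sub_cancel_right]))),
          colFactor, if_pos hmem, endFactor_of_consec hP hq, colFactor, if_neg, endCofactor,
          if_pos ⟨_, by rwa [add_sub_cancel_right]⟩]
        · ring
        · intro h
          exact not_mem_sub_one hP hq.right_mem.1 h (by rwa [add_sub_cancel_right])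
    · left
      refine ⟨p, fun t => ?_, ?_⟩
      · rw [Subtype.ext_iff]
        exact or_iff_left fun h => hq ⟨t, h⟩
      · rw [Matrix.of_apply, CW_of_mem (colOf_mem_supp hP i hpP), colFactor]
        split_ifs with hmem
        · rw [endFactor, dif_neg hq]
        · rw [endCofactor, if_neg, sub_add_cancel]
          rintro ⟨r, hr⟩
          rw [pairKey, if_pos ⟨r, hr⟩] at hkp
          have := (mem_supp_iff_mem.1 (colOf_mem_supp hP i hpP)).resolve_left hmem
          exact hmem (by rwa [hkp] at this)

theorem Delta_eq_prod [NeZero n] (hP : IsAdmissible n P) (i : ZMod n) :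
    Delta n P i = ∏ p ∈ P, colFactor P p (colOf n P i p) :=
  det_eq_prod_colFactor hP i subset_rfl fun _ _ h => iff_of_true h.left_mem.1 h.right_mem.1

theorem mem_Schanged [NeZero n] (hP : IsAdmissible n P) {i : ZMod n} {p : Prp n} :
    p ∈ Schanged n P i ↔ p ∈ P ∧ colOf n P (i - 1) p ≠ colOf n P i p := by
  rw [Schanged, Finset.mem_filter]
  refine and_congr_right fun hp => ?_
  rw [gnAssign_eq hP _ hp, gnAssign_eq hP _ hp, Ne, Option.some_inj]

theorem rfac_eq_prod [NeZero n] (hP : IsAdmissible n P) (i : ZMod n) :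
    rfac n P i = ∏ p ∈ Schanged n P i, colFactor P p (colOf n P i p) := by
  refine det_eq_prod_colFactor hP i (fun p hp => ((mem_Schanged hP).1 hp).1) fun p q h => ?_
  rw [mem_Schanged hP, mem_Schanged hP]
  refine and_congr (iff_of_true h.left_mem.1 h.right_mem.1) (not_congr ?_)
  rw [colOf_left_iff hP h, colOf_right hP (i := i) h rfl]

theorem Rpoly_eq_prod [NeZero n] (hP : IsAdmissible n P) : Rpoly n P =
    ∏ i : ZMod n, ∏ p ∈ P, if colOf n P (i - 1) p ≠ colOf n P i p then
      colFactor P p (colOf n P i p) else 1 := by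
  refine Finset.prod_congr rfl fun i _ => ?_
  rw [rfac_eq_prod hP, ← Finset.prod_filter]
  refine Finset.prod_congr ?_ fun _ _ => rfl
  ext p
  rw [mem_Schanged hP, Finset.mem_filter]

/-- The denominator as a product over the ends of the propagators. -/
theorem Rpoly_eq_prod_ends [NeZero n] (hP : IsAdmissible n P) : Rpoly n P =
    ∏ p ∈ P, ∏ e ∈ p.toFinset, endFactor P e p * endCofactor P e p := by
  rw [Rpoly_eq_prod hP, Finset.prod_comm]
  refine Finset.prod_congr rfl fun p hp => ?_
  induction p using Sym2.ind with
  | _ a b =>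
    obtain ⟨n1, n2, n3, n4, n5⟩ := ends_ne hP hp
    rw [prod_full_turn hP (colFactor P s(a, b)) hp, Sym2.toFinset_mk_eq, Finset.prod_pair n1]
    simp [colFactor, n2, n3, n4, n5]


theorem isCcwLast_iff {e : ZMod n} {p : Prp n} (hp : p ∈ onEdge n P e) :
    IsCcwLast n P e p ↔ ¬ ∃ q, ConsecOnEdge n P e p q := by
  constructor
  · rintro h ⟨q, hq⟩
    exact (h.2 q hq.2.1).not_gt hq.2.2.1
  · intro h
    refine ⟨hp, fun q hq => ?_⟩
    by_contra hcon
    obtain ⟨r, hr, hmax⟩ := ((onEdge n P e).filter fun q => edgeKey n e q < edgeKey n e p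
      ).exists_max_image (edgeKey n e) ⟨q, Finset.mem_filter.2 ⟨hq, not_le.1 hcon⟩⟩
    rw [Finset.mem_filter] at hr
    exact h ⟨r, hp, hr.1, hr.2, fun s hs hs' =>
      (hmax s (Finset.mem_filter.2 ⟨hs, hs'.2⟩)).not_gt hs'.1⟩

theorem isCcwFirst_iff {e : ZMod n} {p : Prp n} (hp : p ∈ onEdge n P e) :
    IsCcwFirst n P e p ↔ ¬ ∃ q, ConsecOnEdge n P e q p := by
  constructor
  · rintro h ⟨q, hq⟩
    exact (h.2 q hq.1).not_gt hq.2.2.1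
  · intro h
    refine ⟨hp, fun q hq => ?_⟩
    by_contra hcon
    obtain ⟨r, hr, hmin⟩ := ((onEdge n P e).filter fun q => edgeKey n e p < edgeKey n e q
      ).exists_min_image (edgeKey n e) ⟨q, Finset.mem_filter.2 ⟨hq, not_le.1 hcon⟩⟩
    rw [Finset.mem_filter] at hr
    exact h ⟨r, hr.1, hp, hr.2, fun s hs hs' =>
      (hmin s (Finset.mem_filter.2 ⟨hs, hs'.1⟩)).not_gt hs'.2⟩

theorem Redge_eq_prod [NeZero n] (hP : IsAdmissible n P) (e : ZMod n) :
    Redge n P e = ∏ p ∈ onEdge n P e, endFactor P e p * endCofactor P e p := by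
  have hmid : ∏ pq ∈ (P ×ˢ P).filter (fun pq => ConsecOnEdge n P e pq.1 pq.2),
      (MvPolynomial.X (pq.1, e) * MvPolynomial.X (pq.2, e + 1) -
        MvPolynomial.X (pq.2, e) * MvPolynomial.X (pq.1, e + 1) :
          MvPolynomial (Prp n × ZMod n) ℝ) =
      ∏ p ∈ onEdge n P e, if ∃ q, ConsecOnEdge n P e p q then endFactor P e p else 1 := by
    rw [← Finset.prod_filter]
    refine Finset.prod_bij (fun pq _ => pq.1) ?_ ?_ ?_ ?_
    · intro pq h
      have h := (Finset.mem_filter.1 h).2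
      exact Finset.mem_filter.2 ⟨h.1, _, h⟩
    · rintro ⟨p, q⟩ h ⟨p', q'⟩ h' heq
      have h := (Finset.mem_filter.1 h).2
      have h' := (Finset.mem_filter.1 h').2
      simp only at heq h h'
      subst heq
      rw [h.right_unique hP h']
    · intro p h
      obtain ⟨q, hq⟩ := (Finset.mem_filter.1 h).2
      exact ⟨(p, q), Finset.mem_filter.2 ⟨Finset.mem_product.2
        ⟨hq.left_mem.1, hq.right_mem.1⟩, hq⟩, rfl⟩
    · intro pq h
      exact (endFactor_of_consec hP (Finset.mem_filter.1 h).2).symm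
  rw [Redge, hmid, Finset.prod_filter, Finset.prod_filter, ← Finset.prod_mul_distrib,
    ← Finset.prod_mul_distrib]
  refine Finset.prod_congr rfl fun p hp => ?_
  rw [isCcwLast_iff hp, isCcwFirst_iff hp, endCofactor]
  by_cases h1 : ∃ q, ConsecOnEdge n P e p q
  · rw [if_pos h1, if_neg (not_not.2 h1)]
    split_ifs <;> ring
  · rw [if_neg h1, if_pos h1, endFactor, dif_neg h1]
    split_ifs <;> ring

theorem RW_eq_prod_ends [NeZero n] (hP : IsAdmissible n P) : RW n P =
    ∏ p ∈ P, ∏ e ∈ p.toFinset, endFactor P e p * endCofactor P e p := by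
  rw [RW, Finset.prod_congr rfl fun e _ => Redge_eq_prod hP e]
  refine Finset.prod_comm' fun e p => ?_
  simp [onEdge, and_comm]

theorem RW_eq_Rpoly [NeZero n] (hP : IsAdmissible n P) : RW n P = Rpoly n P := by
  rw [RW_eq_prod_ends hP, Rpoly_eq_prod_ends hP]

theorem RW_dvd_prod_Delta [NeZero n] (hP : IsAdmissible n P) :
    RW n P ∣ ∏ i : ZMod n, Delta n P i := by
  rw [RW_eq_Rpoly hP]
  refine Finset.prod_dvd_prod_of_dvd _ _ fun i _ => ?_
  rw [rfac_eq_prod hP, Delta_eq_prod hP]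
  exact Finset.prod_dvd_prod_of_subset _ _ _ fun p hp => ((mem_Schanged hP).1 hp).1

theorem colFactor_dvd_RW [NeZero n] (hP : IsAdmissible n P) {p : Prp n} (hp : p ∈ P)
    {v : ZMod n} (hv : v ∈ supp n p) : colFactor P p v ∣ RW n P := by
  rw [RW_eq_prod_ends hP]
  refine dvd_trans ?_ (Finset.dvd_prod_of_mem _ hp)
  rw [colFactor]
  split_ifs with h
  · exact dvd_trans (dvd_mul_right _ _) (Finset.dvd_prod_of_mem _ (Sym2.mem_toFinset.2 h))
  · exact dvd_trans (dvd_mul_left _ _) (Finset.dvd_prod_of_mem _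
      (Sym2.mem_toFinset.2 ((mem_supp_iff_mem.1 hv).resolve_left h)))

theorem prod_Delta_dvd_RW_pow [NeZero n] (hP : IsAdmissible n P) :
    ∃ k, ∏ i : ZMod n, Delta n P i ∣ RW n P ^ k := by
  refine ⟨n * P.card, ?_⟩
  have : RW n P ^ (n * P.card) = ∏ _i : ZMod n, ∏ _p ∈ P, RW n P := by
    simp [ZMod.card, ← pow_mul, mul_comm]
  rw [this]
  refine Finset.prod_dvd_prod_of_dvd _ _ fun i _ => ?_
  rw [Delta_eq_prod hP]
  exact Finset.prod_dvd_prod_of_dvd _ _ fun p hp => colFactor_dvd_RW hP hp (colOf_mem_supp hP i hp)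


section Minor
open MvPolynomial
variable {σ : Type*}

theorem isRelPrime_of_eval {f g : MvPolynomial σ ℝ} (hf : Irreducible f) (x : σ → ℝ)
    (hfx : eval x f = 0) (hgx : eval x g ≠ 0) : IsRelPrime f g := by
  rw [hf.isRelPrime_iff_not_dvd]
  rintro ⟨h, rfl⟩
  exact hgx (by rw [map_mul, hfx, zero_mul])

theorem irreducible_minor {a b c d : σ} (hab : a ≠ b) (hac : a ≠ c) (had : a ≠ d) (hdb : d ≠ b)
    (hdc : d ≠ c) : Irreducible (X a * X d - X b * X c : MvPolynomial σ ℝ) := by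
  have : (X a * X d - X b * X c : MvPolynomial σ ℝ) = X d * X a + -(X b * X c) := by ring
  rw [this]
  refine irreducible_mul_X_add _ _ _ (X_ne_zero d) (by simpa [vars_X] using had) ?_ ?_
  · rw [vars_neg]
    intro h
    have := vars_mul _ _ h
    simp [vars_X, hab, hac] at this
  · refine isRelPrime_of_eval (X_prime).irreducible (fun s => if s = d then 0 else 1) ?_ ?_
    · simp
    · simp [hdb.symm, hdc.symm]

theorem isRelPrime_X_X {a b : σ} (hab : a ≠ b) :
    IsRelPrime (X a : MvPolynomial σ ℝ) (X b) :=
  isRelPrime_of_eval (X_prime).irreducible (fun s => if s = a then 0 else 1) (by simp)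
    (by simp [hab.symm])

theorem isRelPrime_minor_X {a b c d : σ} (hab : a ≠ b) (hac : a ≠ c) (had : a ≠ d) (hdb : d ≠ b)
    (hdc : d ≠ c) (hbc : b ≠ c) (w : σ) :
    IsRelPrime (X a * X d - X b * X c : MvPolynomial σ ℝ) (X w) := by
  refine isRelPrime_of_eval (irreducible_minor hab hac had hdb hdc)
    (fun s => if s = w then 1 else 0) ?_ (by simp)
  simp only [map_sub, map_mul, eval_X]
  split_ifs <;> simp_all

theorem isRelPrime_minor_minor {a b c d a' b' c' d' : σ} (hab : a ≠ b) (hac : a ≠ c) (had : a ≠ d)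
    (hdb : d ≠ b) (hdc : d ≠ c) (hbc : b ≠ c) (hab' : a' ≠ b') (hdb' : d' ≠ b')
    (h1 : ¬ (a = a' ∧ d = d')) (h2 : ¬ (a = d' ∧ d = a')) (h3 : ¬ (b = a' ∧ c = d'))
    (h4 : ¬ (b = d' ∧ c = a')) :
    IsRelPrime (X a * X d - X b * X c : MvPolynomial σ ℝ) (X a' * X d' - X b' * X c') := by
  refine isRelPrime_of_eval (irreducible_minor hab hac had hdb hdc)
    (fun s => if s = a' ∨ s = d' then 1 else 0) ?_ ?_
  · simp only [map_sub, map_mul, eval_X]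
    have e1 : ¬ ((a = a' ∨ a = d') ∧ (d = a' ∨ d = d')) := by
      rintro ⟨rfl | rfl, rfl | rfl⟩ <;> simp_all
    have e2 : ¬ ((b = a' ∨ b = d') ∧ (c = a' ∨ c = d')) := by
      rintro ⟨rfl | rfl, rfl | rfl⟩ <;> simp_all
    rw [ite_zero_mul_ite_zero, ite_zero_mul_ite_zero, if_neg e1, if_neg e2, sub_zero]
  · simp [hab'.symm, hdb'.symm]

end Minor

theorem RW_eq_prod_sigma [NeZero n] (hP : IsAdmissible n P) :
    RW n P = ∏ x ∈ P.sigma (fun p => supp n p), colFactor P x.1 x.2 := by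
  rw [RW_eq_prod_ends hP, Finset.prod_sigma]
  refine Finset.prod_congr rfl fun p hp => ?_
  induction p using Sym2.ind with
  | _ a b =>
    obtain ⟨n1, n2, n3, n4, n5⟩ := ends_ne hP hp
    have : supp n s(a, b) = {a, a + 1, b, b + 1} := by
      ext v; simp [mem_supp_mk]
    rw [this, Sym2.toFinset_mk_eq, Finset.prod_pair n1, Finset.prod_insert, Finset.prod_insert,
      Finset.prod_pair n5.symm]
    · simp [colFactor, n2, n3, n4, n5, mul_assoc]
    · simp [n1, n2]
    · simp [n1, n3.symm, n4.symm]

theorem colFactor_cases [NeZero n] (hP : IsAdmissible n P) (p : Prp n) (v : ZMod n) :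
    colFactor P p v = 1 ∨ colFactor P p v = MvPolynomial.X (p, v) ∨
      ∃ q, ConsecOnEdge n P v p q ∧ colFactor P p v =
        MvPolynomial.X (p, v) * MvPolynomial.X (q, v + 1) -
          MvPolynomial.X (q, v) * MvPolynomial.X (p, v + 1) := by
  unfold colFactor
  split_ifs with h
  · by_cases hq : ∃ q, ConsecOnEdge n P v p q
    · obtain ⟨q, hq⟩ := hq
      exact Or.inr (Or.inr ⟨q, hq, endFactor_of_consec hP hq⟩)
    · rw [endFactor, dif_neg hq]; simp
  · unfold endCofactor
    split_ifs <;> simp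

theorem add_natCast_ne [NeZero n] (v : ZMod n) {k : ℕ} (h0 : 0 < k) (hk : k < n) :
    v + (k : ZMod n) ≠ v := fun h => by
  have := ord_add_natCast v hk
  rw [h, ord_self] at this
  omega

theorem squarefree_RW [NeZero n] (hP : IsAdmissible n P) : Squarefree (RW n P) := by
  rw [RW_eq_prod_sigma hP]
  have hn := hP.card_add_four_le
  have t1 : ∀ v : ZMod n, v + 1 ≠ v := fun v => by
    simpa using add_natCast_ne v (k := 1) (by omega) (by omega)
  have t2 : ∀ v : ZMod n, v + 1 + 1 ≠ v := fun v => by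
    have := add_natCast_ne v (k := 2) (by omega) (by omega)
    rwa [Nat.cast_two, ← one_add_one_eq_two, ← add_assoc] at this
  refine Finset.squarefree_prod_of_pairwise_isCoprime ?_ ?_
  · rintro ⟨p, v⟩ - ⟨p', v'⟩ - hne
    have hne' : ¬ (p = p' ∧ v = v') := by
      rintro ⟨rfl, rfl⟩; exact hne rfl
    simp only [Function.onFun]
    rcases colFactor_cases hP p v with h | h | ⟨q, hq, h⟩ <;> rw [h]
    · exact isRelPrime_one_left
    · rcases colFactor_cases hP p' v' with h' | h' | ⟨q', hq', h'⟩ <;> rw [h']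
      · exact isRelPrime_one_right
      · exact isRelPrime_X_X (by simpa using hne')
      · have := hq'.ne
        refine (isRelPrime_minor_X ?_ ?_ ?_ ?_ ?_ ?_ _).symm <;>
          simp [this, this.symm, t1, (t1 _).symm]
    · have n1 := hq.ne
      rcases colFactor_cases hP p' v' with h' | h' | ⟨q', hq', h'⟩ <;> rw [h']
      · exact isRelPrime_one_right
      · refine isRelPrime_minor_X ?_ ?_ ?_ ?_ ?_ ?_ _ <;>
          simp [n1, n1.symm, t1, (t1 _).symm]
      · have n2 := hq'.ne
        have n3 : v = v' → q = p' → p ≠ q' := by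
          rintro rfl rfl rfl
          exact lt_asymm hq.2.2.1 hq'.2.2.1
        have n4 : v = v' + 1 → v + 1 ≠ v' := by
          rintro rfl; exact t2 v'
        refine isRelPrime_minor_minor ?_ ?_ ?_ ?_ ?_ ?_ ?_ ?_ ?_ ?_ ?_ ?_ <;>
          simp only [ne_eq, Prod.mk.injEq] <;>
          simp [n1, n1.symm, n2, t1, (t1 _).symm]
        · tauto
        · tauto
        · tauto
        · tauto
  · rintro ⟨p, v⟩ -
    rcases colFactor_cases hP p v with h | h | ⟨q, hq, h⟩ <;> rw [h]
    · exact squarefree_one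
    · exact MvPolynomial.X_prime.irreducible.squarefree
    · have := hq.ne
      refine (irreducible_minor ?_ ?_ ?_ ?_ ?_).squarefree <;>
        simp [this, this.symm, t1, (t1 _).symm]

end WLD

namespace WLD

/-- the denominator `R(W)` via the Grassmann necklace.
Let `W` be an admissible Wilson loop diagram with `k` propagators and Grassmann
necklace `(I_1, …, I_n)`.  Then the denominator `R(W) = ∏ₑ R_e` equals the
polynomial `R = ∏ᵢ rᵢ` produced by the Algorithm, and the ideal generated by
`R(W)` is the radical of the ideal generated by `∏ᵢ Δ_{I_i}`, where `Δ_{I_i}`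
is the determinant of the `k×k` minor of `C(W)` with columns indexed by
`I_i`. -/
theorem denominator_eq_Rpoly_and_radical
    (n : ℕ) [NeZero n] (P : Finset (Prp n)) (hadm : IsAdmissible n P) :
    RW n P = Rpoly n P ∧
    Ideal.span {RW n P} = (Ideal.span {∏ i : ZMod n, Delta n P i}).radical := by
  refine ⟨RW_eq_Rpoly hadm, le_antisymm ?_ fun x hx => ?_⟩
  · rw [Ideal.span_singleton_le_iff_mem]
    obtain ⟨k, hk⟩ := prod_Delta_dvd_RW_pow hadm
    exact ⟨k, Ideal.mem_span_singleton.2 hk⟩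
  · obtain ⟨k, hk⟩ := hx
    exact Ideal.mem_span_singleton.2 ((squarefree_RW hadm).isRadical k x
      ((RW_dvd_prod_Delta hadm).trans (Ideal.mem_span_singleton.1 hk)))

end WLD
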